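/- arXiv:1909.08448 — 6 statements merged into one kernel-verified Lean document; each statement's English description precedes it below -/
import Mathlib

section
/- Let d ≥ 1 and let y = (y_I), indexed by the nonempty subsets I of [d] = {1,…,d}, be a vector of real numbers. Set P⁻ = Σ_{I : y_I < 0} (−y_I)·Δ_I and P⁺ = Σ_{I : y_I ≥ 0} y_I·Δ_I (Minkowski sums of dilated standard simplices). Then there exists a generalized permutahedron R ⊆ ℝ^d with P⁻ + R = P⁺ (i.e., the signed Minkowski sum Σ_I y_I Δ_I defines a generalized permutahedron) if and only if for every 2-element subset E ⊆ [d] and every subset T with E ⊆ T ⊆ [d] one has Σ_{I : E ⊆ I ⊆ T} y_I ≥ 0. -/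
open Finset Pointwise

/-- The standard simplex `Δ_I ⊆ ℝ^d`: the convex hull of `{e_i : i ∈ I}`. -/
def stdSimp (d : ℕ) (I : Finset (Fin d)) : Set (Fin d → ℝ) :=
  convexHull ℝ ((fun i => (Pi.single i 1 : Fin d → ℝ)) '' (I : Set (Fin d)))

/-- The permutahedron `Π_d`: the convex hull of the points `(σ(1),…,σ(d))`. -/
def permutahedron (d : ℕ) : Set (Fin d → ℝ) :=
  convexHull ℝ {x | ∃ σ : Equiv.Perm (Fin d), x = fun i => ((σ i : ℕ) + 1 : ℝ)}

/-- A polytope is the convex hull of a finite set of points. -/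
def IsPolytope {d : ℕ} (P : Set (Fin d → ℝ)) : Prop :=
  ∃ S : Finset (Fin d → ℝ), P = convexHull ℝ (S : Set (Fin d → ℝ))

/-- A generalized permutahedron: a polytope `P` such that `P + Q = λ • Π_d`
for some polytope `Q` and some `λ > 0`. -/
def IsGenPerm {d : ℕ} (P : Set (Fin d → ℝ)) : Prop :=
  IsPolytope P ∧ ∃ lam : ℝ, 0 < lam ∧ ∃ Q : Set (Fin d → ℝ), IsPolytope Q ∧
    P + Q = lam • permutahedron d

/-- The value of `u` at the `σ`-largest element of `I` (and `0` if `I` is empty). -/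
def topVal {d : ℕ} (σ : Equiv.Perm (Fin d)) (u : Fin d → ℝ) (I : Finset (Fin d)) : ℝ :=
  ∑ i, if i ∈ I ∧ ∀ j ∈ I, σ j ≤ σ i then u i else 0

/-- The maximum of `u` on `I` (and `0` if `I` is empty). -/
noncomputable def maxVal {d : ℕ} (u : Fin d → ℝ) (I : Finset (Fin d)) : ℝ :=
  sSup (u '' (I : Set (Fin d)))

/-- The greedy point of the signed Minkowski sum `∑ y_I Δ_I` attached to `σ`. -/
def greedyPoint {d : ℕ} (y : Finset (Fin d) → ℝ) (σ : Equiv.Perm (Fin d)) : Fin d → ℝ :=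
  fun i => ∑ I, if i ∈ I ∧ ∀ j ∈ I, σ j ≤ σ i then y I else 0

/-- The convex hull of the greedy points. -/
def greedyPolytope {d : ℕ} (y : Finset (Fin d) → ℝ) : Set (Fin d → ℝ) :=
  convexHull ℝ (Set.range (greedyPoint y))

/-- The inequalities characterising the signed Minkowski sums that are generalized permutahedra. -/
def IntervalNonneg {d : ℕ} (y : Finset (Fin d) → ℝ) : Prop :=
  ∀ E T : Finset (Fin d), E.card = 2 → E ⊆ T →
    0 ≤ ∑ I ∈ univ.filter (fun I : Finset (Fin d) => E ⊆ I ∧ I ⊆ T), y I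

/-- The coefficients of the permutahedron as a Minkowski sum of standard simplices. -/
def permCoeff {d : ℕ} (I : Finset (Fin d)) : ℝ :=
  if I.card = 1 ∨ I.card = 2 then 1 else 0

section Values

variable {d : ℕ} (σ : Equiv.Perm (Fin d)) (u : Fin d → ℝ) {I : Finset (Fin d)}

lemma topVal_eq {b : Fin d} (hb : b ∈ I) (hmax : ∀ j ∈ I, σ j ≤ σ b) :
    topVal σ u I = u b := by
  unfold topVal
  rw [Finset.sum_eq_single b, if_pos ⟨hb, hmax⟩]
  · intro i _ hib
    refine if_neg fun h => hib (σ.injective (le_antisymm (hmax i h.1) (h.2 b hb)))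
  · simp

lemma topVal_empty : topVal σ u ∅ = 0 := by simp [topVal]

lemma maxVal_empty : maxVal u ∅ = 0 := by simp [maxVal]

lemma isGreatest_maxVal (hI : I.Nonempty) : IsGreatest (u '' (I : Set (Fin d))) (maxVal u I) :=
  ((I.finite_toSet.image u).isCompact).isGreatest_sSup (by simpa using hI)

lemma exists_sigma_max (hI : I.Nonempty) : ∃ b ∈ I, ∀ j ∈ I, σ j ≤ σ b :=
  I.exists_max_image σ hI

lemma topVal_le_maxVal : topVal σ u I ≤ maxVal u I := by
  rcases I.eq_empty_or_nonempty with rfl | hI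
  · rw [topVal_empty, maxVal_empty]
  · obtain ⟨b, hb, hmax⟩ := exists_sigma_max σ hI
    rw [topVal_eq σ u hb hmax]
    exact (isGreatest_maxVal u hI).2 ⟨b, hb, rfl⟩

lemma topVal_eq_maxVal (h : ∀ i j, σ i ≤ σ j → u i ≤ u j) : topVal σ u I = maxVal u I := by
  refine le_antisymm (topVal_le_maxVal σ u) ?_
  rcases I.eq_empty_or_nonempty with rfl | hI
  · rw [topVal_empty, maxVal_empty]
  · obtain ⟨b, hb, hmax⟩ := exists_sigma_max σ hI
    obtain ⟨i, hi, hiu⟩ := (isGreatest_maxVal u hI).1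
    rw [topVal_eq σ u hb hmax, ← hiu]
    exact h i b (hmax i hi)

lemma exists_sorting_perm : ∃ σ : Equiv.Perm (Fin d), ∀ i j, σ i ≤ σ j → u i ≤ u j := by
  refine ⟨(Tuple.sort u)⁻¹, fun i j h => ?_⟩
  simpa using Tuple.monotone_sort u h

lemma sum_indicator_nonneg {y : Finset (Fin d) → ℝ} (hy : IntervalNonneg y) (t : ℝ) :
    0 ≤ ∑ I, y I * (Set.Ico (topVal σ u I) (maxVal u I)).indicator 1 t := by
  classical
  let P : Fin d × Fin d → Finset (Fin d) → Prop := fun p I =>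
    (p.2 ∈ I ∧ (∀ j ∈ I, σ j ≤ σ p.2) ∧ u p.2 ≤ t) ∧
      p.1 ∈ I ∧ t < u p.1 ∧ ∀ j ∈ I, t < u j → σ j ≤ σ p.1
  have key : ∀ I, y I * (Set.Ico (topVal σ u I) (maxVal u I)).indicator 1 t
      = ∑ p, if P p I then y I else 0 := by
    intro I
    by_cases hex : ∃ p, P p I
    · obtain ⟨p, hp⟩ := hex
      have hne : I.Nonempty := ⟨_, hp.1.1⟩
      rw [Finset.sum_eq_single p, if_pos hp, Set.indicator_of_mem]
      · simp
      · rw [topVal_eq σ u hp.1.1 hp.1.2.1]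
        exact ⟨hp.1.2.2, hp.2.2.1.trans_le ((isGreatest_maxVal u hne).2 ⟨_, hp.2.1, rfl⟩)⟩
      · intro q _ hqp
        refine if_neg fun hq => hqp (Prod.ext ?_ ?_)
        · exact σ.injective (le_antisymm (hp.2.2.2 _ hq.2.1 hq.2.2.1)
            (hq.2.2.2 _ hp.2.1 hp.2.2.1))
        · exact σ.injective (le_antisymm (hp.1.2.1 _ hq.1.1) (hq.1.2.1 _ hp.1.1))
      · simp
    · rw [Finset.sum_eq_zero fun p _ => if_neg fun hp => hex ⟨p, hp⟩, Set.indicator_of_notMem,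
        mul_zero]
      rintro ⟨h1, h2⟩
      rcases I.eq_empty_or_nonempty with rfl | hI
      · rw [topVal_empty] at h1
        rw [maxVal_empty] at h2
        exact absurd h1 (not_le.2 h2)
      obtain ⟨b, hb, hmax⟩ := exists_sigma_max σ hI
      obtain ⟨i, hi, hiu⟩ := (isGreatest_maxVal u hI).1
      obtain ⟨a, ha, hamax⟩ := exists_sigma_max σ (I := I.filter fun j => t < u j)
        ⟨i, Finset.mem_filter.2 ⟨hi, hiu ▸ h2⟩⟩
      rw [Finset.mem_filter] at ha
      rw [topVal_eq σ u hb hmax] at h1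
      exact hex ⟨(a, b), ⟨hb, hmax, h1⟩, ha.1, ha.2,
        fun j hj hjt => hamax j (Finset.mem_filter.2 ⟨hj, hjt⟩)⟩
  rw [Finset.sum_congr rfl fun I _ => key I, Finset.sum_comm]
  refine Finset.sum_nonneg fun p _ => ?_
  rw [← Finset.sum_filter]
  rcases (univ.filter (P p)).eq_empty_or_nonempty with h | ⟨J, hJ⟩
  · simp [h]
  obtain ⟨⟨hb, hbmax, hbt⟩, ha, hat, hamax⟩ := (Finset.mem_filter.1 hJ).2
  have hne : p.1 ≠ p.2 := fun h => absurd hbt (not_le.2 (h ▸ hat))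
  have := hy {p.1, p.2} (univ.filter fun j => σ j ≤ σ p.2 ∧ (t < u j → σ j ≤ σ p.1))
    (Finset.card_pair hne) (by
      intro j hj
      rcases Finset.mem_insert.1 hj with rfl | hj
      · simpa using hbmax _ ha
      · rw [Finset.mem_singleton] at hj
        subst hj
        simpa using fun h => absurd hbt (not_le.2 h))
  refine this.trans_eq (Finset.sum_congr ?_ fun _ _ => rfl)
  ext I
  simp only [P, Finset.mem_filter, Finset.mem_univ, true_and, Finset.insert_subset_iff,
    Finset.singleton_subset_iff]
  simp only [Finset.subset_iff, Finset.mem_filter, Finset.mem_univ, true_and]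
  constructor
  · rintro ⟨⟨h1, h2⟩, h3⟩
    exact ⟨⟨h2, fun j hj => (h3 hj).1, hbt⟩, h1, hat, fun j hj => (h3 hj).2⟩
  · rintro ⟨⟨h1, h2, -⟩, h3, -, h4⟩
    exact ⟨⟨h3, h1⟩, fun j hj => ⟨h2 j hj, h4 j hj⟩⟩

lemma sum_topVal_le_sum_maxVal {y : Finset (Fin d) → ℝ} (hy : IntervalNonneg y) :
    ∑ I, y I * topVal σ u I ≤ ∑ I, y I * maxVal u I := by
  have h := MeasureTheory.integral_nonneg (μ := MeasureTheory.volume)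
    (f := fun t => ∑ I, y I * (Set.Ico (topVal σ u I) (maxVal u I)).indicator 1 t)
    (sum_indicator_nonneg σ u hy)
  rw [MeasureTheory.integral_finsetSum] at h
  · have hI : ∀ I : Finset (Fin d),
        ∫ t, y I * (Set.Ico (topVal σ u I) (maxVal u I)).indicator 1 t
          = y I * maxVal u I - y I * topVal σ u I := by
      intro I
      rw [MeasureTheory.integral_const_mul, MeasureTheory.integral_indicator_one measurableSet_Ico,
        Real.volume_real_Ico_of_le (topVal_le_maxVal σ u), mul_sub]
    rw [Finset.sum_congr rfl fun I _ => hI I, Finset.sum_sub_distrib] at h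
    linarith
  · intro I _
    refine MeasureTheory.Integrable.const_mul ?_ _
    exact (MeasureTheory.integrable_indicator_iff measurableSet_Ico).2
      (MeasureTheory.integrableOn_const (by simp))

end Values

section Support

variable {d : ℕ}

/-- The values of a linear functional on the standard basis. -/
def basisValues (L : (Fin d → ℝ) →ₗ[ℝ] ℝ) : Fin d → ℝ := fun i => L (Pi.single i 1)

lemma map_greedyPoint (L : (Fin d → ℝ) →ₗ[ℝ] ℝ) (y : Finset (Fin d) → ℝ)
    (σ : Equiv.Perm (Fin d)) :
    L (greedyPoint y σ) = ∑ I, y I * topVal σ (basisValues L) I := by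
  rw [LinearMap.pi_apply_eq_sum_univ L]
  simp only [greedyPoint, topVal, smul_eq_mul, Finset.sum_mul, Finset.mul_sum]
  rw [Finset.sum_comm]
  refine Finset.sum_congr rfl fun I _ => Finset.sum_congr rfl fun i _ => ?_
  split_ifs
  · simp only [basisValues]
    congr 2
    ext j
    simp [Pi.single_apply, eq_comm]
  · simp

lemma isGreatest_convexHull {S : Set (Fin d → ℝ)} {L : (Fin d → ℝ) →ₗ[ℝ] ℝ} {c : ℝ}
    (h : IsGreatest (L '' S) c) : IsGreatest (L '' convexHull ℝ S) c := by
  refine ⟨Set.image_mono (subset_convexHull ℝ S) h.1, ?_⟩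
  rintro _ ⟨x, hx, rfl⟩
  exact convexHull_min (t := {x | L x ≤ c}) (fun x hx => h.2 ⟨x, hx, rfl⟩)
    (convex_halfSpace_le L.isLinear c) hx

lemma isGreatest_add {S T : Set (Fin d → ℝ)} {L : (Fin d → ℝ) →ₗ[ℝ] ℝ} {a b : ℝ}
    (hS : IsGreatest (L '' S) a) (hT : IsGreatest (L '' T) b) :
    IsGreatest (L '' (S + T)) (a + b) := by
  rw [Set.image_add]
  exact ⟨Set.add_mem_add hS.1 hT.1, add_mem_upperBounds_add hS.2 hT.2⟩

lemma isGreatest_smul {S : Set (Fin d → ℝ)} {L : (Fin d → ℝ) →ₗ[ℝ] ℝ} {a c : ℝ}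
    (hc : 0 ≤ c) (hS : IsGreatest (L '' S) a) : IsGreatest (L '' (c • S)) (c * a) := by
  obtain ⟨⟨x, hx, rfl⟩, h⟩ := hS
  refine ⟨⟨c • x, Set.smul_mem_smul_set hx, by simp⟩, ?_⟩
  rintro _ ⟨_, ⟨z, hz, rfl⟩, rfl⟩
  simpa using mul_le_mul_of_nonneg_left (h ⟨z, hz, rfl⟩) hc

lemma isGreatest_stdSimp (L : (Fin d → ℝ) →ₗ[ℝ] ℝ) {I : Finset (Fin d)} (hI : I.Nonempty) :
    IsGreatest (L '' stdSimp d I) (maxVal (basisValues L) I) := by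
  refine isGreatest_convexHull ?_
  rw [Set.image_image]
  exact isGreatest_maxVal (basisValues L) hI

lemma isGreatest_sum_stdSimp (L : (Fin d → ℝ) →ₗ[ℝ] ℝ) (c : Finset (Fin d) → ℝ)
    (F : Finset (Finset (Fin d))) (hF : ∀ I ∈ F, I.Nonempty ∧ 0 ≤ c I) :
    IsGreatest (L '' ∑ I ∈ F, c I • stdSimp d I) (∑ I ∈ F, c I * maxVal (basisValues L) I) := by
  classical
  induction F using Finset.induction_on with
  | empty => simp [← Set.singleton_zero]
  | insert J F hJ ih =>
    rw [Finset.sum_insert hJ, Finset.sum_insert hJ]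
    obtain ⟨hne, hc⟩ := hF J (Finset.mem_insert_self J F)
    exact isGreatest_add (isGreatest_smul hc (isGreatest_stdSimp L hne))
      (ih fun I hI => hF I (Finset.mem_insert_of_mem hI))

lemma isGreatest_greedyPoint {L : (Fin d → ℝ) →ₗ[ℝ] ℝ} {y : Finset (Fin d) → ℝ}
    (hy : IntervalNonneg y) {σ : Equiv.Perm (Fin d)}
    (hσ : ∀ i j, σ i ≤ σ j → basisValues L i ≤ basisValues L j) :
    IsGreatest (L '' greedyPolytope y) (L (greedyPoint y σ)) := by
  refine isGreatest_convexHull ⟨⟨_, ⟨σ, rfl⟩, rfl⟩, ?_⟩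
  rintro _ ⟨_, ⟨τ, rfl⟩, rfl⟩
  rw [map_greedyPoint, map_greedyPoint]
  simp only [topVal_eq_maxVal σ _ hσ]
  exact sum_topVal_le_sum_maxVal τ _ hy

lemma isGreatest_greedyPolytope (L : (Fin d → ℝ) →ₗ[ℝ] ℝ) {y : Finset (Fin d) → ℝ}
    (hy : IntervalNonneg y) :
    IsGreatest (L '' greedyPolytope y) (∑ I, y I * maxVal (basisValues L) I) := by
  obtain ⟨σ, hσ⟩ := exists_sorting_perm (basisValues L)
  have h := isGreatest_greedyPoint hy hσ
  rw [map_greedyPoint] at h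
  simpa only [topVal_eq_maxVal σ _ hσ] using h

lemma subset_of_isGreatest {A B : Set (Fin d → ℝ)} (hB : Convex ℝ B ∧ IsCompact B)
    (h : ∀ L : (Fin d → ℝ) →ₗ[ℝ] ℝ, ∃ c, IsGreatest (L '' A) c ∧ IsGreatest (L '' B) c) :
    A ⊆ B := by
  intro x hx
  by_contra hxB
  obtain ⟨f, s, hs, hsx⟩ := geometric_hahn_banach_closed_point hB.1 hB.2.isClosed hxB
  obtain ⟨c, hA, ⟨b, hb, hbc⟩, -⟩ := h f.toLinearMap
  have h1 : f x ≤ c := hA.2 ⟨x, hx, rfl⟩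
  have h2 : f b = c := hbc
  linarith [hs b hb]

lemma eq_of_isGreatest {A B : Set (Fin d → ℝ)} (hA : Convex ℝ A ∧ IsCompact A)
    (hB : Convex ℝ B ∧ IsCompact B)
    (h : ∀ L : (Fin d → ℝ) →ₗ[ℝ] ℝ, ∃ c, IsGreatest (L '' A) c ∧ IsGreatest (L '' B) c) :
    A = B :=
  (subset_of_isGreatest hB h).antisymm
    (subset_of_isGreatest hA fun L => (h L).imp fun _ => And.symm)

lemma convex_isCompact_convexHull {S : Set (Fin d → ℝ)} (hS : S.Finite) :
    Convex ℝ (convexHull ℝ S) ∧ IsCompact (convexHull ℝ S) :=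
  ⟨convex_convexHull ℝ S, hS.isCompact_convexHull ℝ⟩

lemma convex_isCompact_add {A B : Set (Fin d → ℝ)} (hA : Convex ℝ A ∧ IsCompact A)
    (hB : Convex ℝ B ∧ IsCompact B) : Convex ℝ (A + B) ∧ IsCompact (A + B) :=
  ⟨hA.1.add hB.1, hA.2.add hB.2⟩

lemma convex_isCompact_smul {A : Set (Fin d → ℝ)} (c : ℝ) (hA : Convex ℝ A ∧ IsCompact A) :
    Convex ℝ (c • A) ∧ IsCompact (c • A) :=
  ⟨hA.1.smul c, hA.2.smul c⟩

lemma convex_isCompact_sum_stdSimp (c : Finset (Fin d) → ℝ) (F : Finset (Finset (Fin d))) :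
    Convex ℝ (∑ I ∈ F, c I • stdSimp d I) ∧ IsCompact (∑ I ∈ F, c I • stdSimp d I) := by
  classical
  induction F using Finset.induction_on with
  | empty => simp [← Set.singleton_zero]
  | insert J F hJ ih =>
    rw [Finset.sum_insert hJ]
    exact convex_isCompact_add (convex_isCompact_smul _
      (convex_isCompact_convexHull (J.finite_toSet.image _))) ih

lemma convex_isCompact_greedyPolytope (y : Finset (Fin d) → ℝ) :
    Convex ℝ (greedyPolytope y) ∧ IsCompact (greedyPolytope y) :=
  convex_isCompact_convexHull (Set.finite_range _)

lemma isPolytope_greedyPolytope (y : Finset (Fin d) → ℝ) : IsPolytope (greedyPolytope y) := by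
  classical
  exact ⟨univ.image (greedyPoint y), by simp [greedyPolytope]⟩

lemma IsPolytope.exists_isGreatest {P : Set (Fin d → ℝ)} (hP : IsPolytope P) (hne : P.Nonempty)
    (L : (Fin d → ℝ) →ₗ[ℝ] ℝ) : ∃ c, IsGreatest (L '' P) c := by
  obtain ⟨S, rfl⟩ := hP
  have hS : (S : Set (Fin d → ℝ)).Nonempty := convexHull_nonempty_iff.1 hne
  exact ⟨_, isGreatest_convexHull
    ((S.finite_toSet.image L).isCompact.isGreatest_sSup (hS.image L))⟩

end Support

section Permutahedron

variable {d : ℕ}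

lemma permCoeff_nonneg (I : Finset (Fin d)) : 0 ≤ permCoeff I := by
  unfold permCoeff
  split_ifs <;> norm_num

lemma intervalNonneg_permCoeff : IntervalNonneg (permCoeff (d := d)) :=
  fun _ _ _ _ => Finset.sum_nonneg fun I _ => permCoeff_nonneg I

lemma greedyPoint_permCoeff (σ : Equiv.Perm (Fin d)) :
    greedyPoint permCoeff σ = fun i => ((σ i : ℕ) + 1 : ℝ) := by
  classical
  funext i
  have himage : (univ.filter fun I : Finset (Fin d) =>
      (i ∈ I ∧ ∀ j ∈ I, σ j ≤ σ i) ∧ (I.card = 1 ∨ I.card = 2))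
      = (univ.filter fun j => σ j ≤ σ i).image fun j => {i, j} := by
    ext I
    simp only [Finset.mem_filter, Finset.mem_univ, true_and, Finset.mem_image]
    constructor
    · rintro ⟨⟨hi, hmax⟩, h | h⟩
      · obtain ⟨a, rfl⟩ := Finset.card_eq_one.1 h
        obtain rfl := Finset.mem_singleton.1 hi
        exact ⟨i, le_rfl, by simp⟩
      · obtain ⟨a, b, hab, rfl⟩ := Finset.card_eq_two.1 h
        rcases Finset.mem_insert.1 hi with rfl | hi
        · exact ⟨b, hmax b (by simp), rfl⟩
        · obtain rfl := Finset.mem_singleton.1 hi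
          exact ⟨a, hmax a (by simp), Finset.pair_comm _ _⟩
    · rintro ⟨j, hj, rfl⟩
      refine ⟨⟨by simp, by simpa using hj⟩, ?_⟩
      rcases eq_or_ne i j with rfl | hij
      · simp
      · exact Or.inr (Finset.card_pair hij)
  have hinj : Function.Injective fun j : Fin d => ({i, j} : Finset (Fin d)) := by
    intro j k (hjk : ({i, j} : Finset (Fin d)) = {i, k})
    have h1 : j ∈ ({i, k} : Finset (Fin d)) := hjk ▸ by simp
    have h2 : k ∈ ({i, j} : Finset (Fin d)) := hjk ▸ by simp
    simp only [Finset.mem_insert, Finset.mem_singleton] at h1 h2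
    grind
  have hcard : (univ.filter fun j => σ j ≤ σ i).card = (σ i : ℕ) + 1 := by
    rw [← Fin.card_Iic, ← Finset.card_map σ.toEmbedding]
    congr 1
    ext j
    simp
  simp only [greedyPoint, permCoeff]
  rw [← Finset.sum_filter, ← Finset.sum_filter, Finset.filter_filter, himage, Finset.sum_const,
    Finset.card_image_of_injective _ hinj, hcard]
  simp

lemma permutahedron_eq_greedyPolytope : permutahedron d = greedyPolytope permCoeff := by
  unfold permutahedron greedyPolytope
  congr 1
  ext x
  simp only [Set.mem_ofPred_eq, Set.mem_range, greedyPoint_permCoeff, eq_comm]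

lemma isGenPerm_greedyPolytope {y : Finset (Fin d) → ℝ} (hy : IntervalNonneg y) :
    IsGenPerm (greedyPolytope y) := by
  set lam : ℝ := 1 + ∑ I, |y I|
  have hpos : 0 < lam := by positivity
  have hy' : IntervalNonneg fun I => lam * permCoeff I - y I := by
    intro E T hE hET
    rw [Finset.sum_sub_distrib, ← Finset.mul_sum]
    have h1 : permCoeff E ≤ ∑ I ∈ univ.filter (fun I => E ⊆ I ∧ I ⊆ T), permCoeff I :=
      Finset.single_le_sum (fun I _ => permCoeff_nonneg I) (by simpa using hET)
    have h2 : ∑ I ∈ univ.filter (fun I => E ⊆ I ∧ I ⊆ T), y I ≤ ∑ I, |y I| :=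
      (Finset.sum_le_sum fun I _ => le_abs_self _).trans
        (Finset.sum_le_sum_of_subset_of_nonneg (Finset.filter_subset _ _)
          fun I _ _ => abs_nonneg _)
    have h3 : permCoeff E = 1 := if_pos (Or.inr hE)
    rw [h3] at h1
    have h4 := mul_le_mul_of_nonneg_left h1 hpos.le
    linarith
  refine ⟨isPolytope_greedyPolytope y, lam, hpos, _, isPolytope_greedyPolytope _,
    eq_of_isGreatest (convex_isCompact_add (convex_isCompact_greedyPolytope y)
      (convex_isCompact_greedyPolytope fun I => lam * permCoeff I - y I)) ?_ fun L => ?_⟩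
  · rw [permutahedron_eq_greedyPolytope]
    exact convex_isCompact_smul lam (convex_isCompact_greedyPolytope _)
  · refine ⟨_, isGreatest_add (isGreatest_greedyPolytope L hy) (isGreatest_greedyPolytope L hy'),
      ?_⟩
    rw [permutahedron_eq_greedyPolytope]
    convert isGreatest_smul hpos.le (isGreatest_greedyPolytope L intervalNonneg_permCoeff) using 1
    rw [Finset.mul_sum, ← Finset.sum_add_distrib]
    exact Finset.sum_congr rfl fun I _ => by ring

lemma IsGenPerm.nonempty {R : Set (Fin d → ℝ)} (hR : IsGenPerm R) : R.Nonempty := by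
  obtain ⟨-, lam, -, Q, -, hQ⟩ := hR
  have : (lam • permutahedron d).Nonempty := by
    rw [permutahedron_eq_greedyPolytope]
    exact ((Set.range_nonempty _).convexHull).smul_set
  rw [← hQ] at this
  exact this.of_add_left

/-- A generalized permutahedron has, for each `σ`, a point maximising every linear functional
whose values on the standard basis are weakly sorted by `σ`. -/
lemma IsGenPerm.exists_common_max {R : Set (Fin d → ℝ)} (hR : IsGenPerm R)
    (σ : Equiv.Perm (Fin d)) :
    ∃ r ∈ R, ∀ L : (Fin d → ℝ) →ₗ[ℝ] ℝ,
      (∀ i j, σ i ≤ σ j → basisValues L i ≤ basisValues L j) → IsGreatest (L '' R) (L r) := by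
  obtain ⟨-, lam, hlam, Q, -, hQ⟩ := hR
  rw [permutahedron_eq_greedyPolytope] at hQ
  have hmem : lam • greedyPoint permCoeff σ ∈ R + Q :=
    hQ ▸ Set.smul_mem_smul_set (subset_convexHull ℝ _ ⟨σ, rfl⟩)
  obtain ⟨r, hr, q, hq, hrq⟩ := hmem
  refine ⟨r, hr, fun L hL => ⟨⟨r, hr, rfl⟩, ?_⟩⟩
  rintro _ ⟨x, hx, rfl⟩
  have h := isGreatest_smul hlam.le (isGreatest_greedyPoint intervalNonneg_permCoeff hL)
  rw [← hQ] at h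
  have h1 := h.2 ⟨_, Set.add_mem_add hx hq, rfl⟩
  rw [← smul_eq_mul, ← map_smul, ← hrq, map_add] at h1
  simpa using h1

end Permutahedron

section Submodularity

variable {d : ℕ}

/-- The linear functional summing the coordinates indexed by `A`. -/
def coordSum (A : Finset (Fin d)) : (Fin d → ℝ) →ₗ[ℝ] ℝ := ∑ i ∈ A, LinearMap.proj i

lemma coordSum_apply (A : Finset (Fin d)) (x : Fin d → ℝ) : coordSum A x = ∑ i ∈ A, x i := by
  simp [coordSum]

lemma basisValues_coordSum (A : Finset (Fin d)) (i : Fin d) :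
    basisValues (coordSum A) i = if i ∈ A then 1 else 0 := by
  simp [basisValues, coordSum_apply, Pi.single_apply]

lemma maxVal_coordSum (A I : Finset (Fin d)) :
    maxVal (basisValues (coordSum A)) I = if ∃ i ∈ I, i ∈ A then 1 else 0 := by
  rcases I.eq_empty_or_nonempty with rfl | hI
  · simp [maxVal_empty]
  refine (isGreatest_maxVal _ hI).unique ?_
  split_ifs with h
  · obtain ⟨i, hi, hiA⟩ := h
    refine ⟨⟨i, hi, by simp [basisValues_coordSum, hiA]⟩, ?_⟩
    rintro _ ⟨j, -, rfl⟩
    rw [basisValues_coordSum]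
    split_ifs <;> norm_num
  · push Not at h
    obtain ⟨i, hi⟩ := hI
    refine ⟨⟨i, hi, by simp [basisValues_coordSum, h i hi]⟩, ?_⟩
    rintro _ ⟨j, hj, rfl⟩
    simp [basisValues_coordSum, h j hj]

lemma IsGenPerm.intervalNonneg {R : Set (Fin d → ℝ)} (hR : IsGenPerm R)
    {y : Finset (Fin d) → ℝ}
    (h : ∀ L : (Fin d → ℝ) →ₗ[ℝ] ℝ,
      IsGreatest (L '' R) (∑ I, y I * maxVal (basisValues L) I)) : IntervalNonneg y := by
  classical
  intro E T hE hET
  obtain ⟨i, j, hij, rfl⟩ := Finset.card_eq_two.1 hE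
  have hi : i ∈ T := hET (by simp)
  have hj : j ∈ T := hET (by simp)
  obtain ⟨σ, hσ⟩ := exists_sorting_perm
    fun k => basisValues (coordSum Tᶜ) k + basisValues (coordSum (insert i (insert j Tᶜ))) k
  obtain ⟨r, hrR, hr⟩ := hR.exists_common_max σ
  have h0 := (hr (coordSum Tᶜ) fun a b hab => by
    have := hσ a b hab
    simp only [basisValues_coordSum, Finset.mem_insert] at this ⊢
    split_ifs at this ⊢ <;> first | (norm_num at this ⊢; done) | grind).unique (h _)
  have h2 := (hr (coordSum (insert i (insert j Tᶜ))) fun a b hab => by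
    have := hσ a b hab
    simp only [basisValues_coordSum, Finset.mem_insert] at this ⊢
    split_ifs at this ⊢ <;> first | (norm_num at this ⊢; done) | grind).unique (h _)
  have h1 := (h (coordSum (insert i Tᶜ))).2 ⟨r, hrR, rfl⟩
  have h1' := (h (coordSum (insert j Tᶜ))).2 ⟨r, hrR, rfl⟩
  have hiT : i ∉ Tᶜ := by simpa using hi
  have hjT : j ∉ Tᶜ := by simpa using hj
  have hijT : i ∉ insert j Tᶜ := by simp [hij, hi]
  rw [coordSum_apply] at h0 h2 h1 h1'
  rw [Finset.sum_insert hiT] at h1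
  rw [Finset.sum_insert hjT] at h1'
  rw [Finset.sum_insert hijT, Finset.sum_insert hjT] at h2
  have hsum : ∑ I ∈ univ.filter (fun I => {i, j} ⊆ I ∧ I ⊆ T), y I
      = ∑ I, y I * maxVal (basisValues (coordSum (insert i Tᶜ))) I
        + ∑ I, y I * maxVal (basisValues (coordSum (insert j Tᶜ))) I
        - ∑ I, y I * maxVal (basisValues (coordSum Tᶜ)) I
        - ∑ I, y I * maxVal (basisValues (coordSum (insert i (insert j Tᶜ)))) I := by
    rw [← Finset.sum_add_distrib, ← Finset.sum_sub_distrib, ← Finset.sum_sub_distrib,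
      Finset.sum_filter]
    refine Finset.sum_congr rfl fun I _ => ?_
    have e1 : ∀ k (A : Finset (Fin d)), (∃ l ∈ I, l ∈ insert k A) ↔ k ∈ I ∨ ∃ l ∈ I, l ∈ A := by
      intro k A
      constructor
      · rintro ⟨l, hl, hlA⟩
        rcases Finset.mem_insert.1 hlA with rfl | hlA
        · exact Or.inl hl
        · exact Or.inr ⟨l, hl, hlA⟩
      · rintro (hk | ⟨l, hl, hlA⟩)
        · exact ⟨k, hk, by simp⟩
        · exact ⟨l, hl, Finset.mem_insert_of_mem hlA⟩
    have e2 : I ⊆ T ↔ ¬ ∃ l ∈ I, l ∈ Tᶜ := by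
      simp [Finset.subset_iff]
    simp only [maxVal_coordSum, e1, e2, Finset.insert_subset_iff, Finset.singleton_subset_iff]
    by_cases hc : ∃ l ∈ I, l ∈ Tᶜ <;> by_cases hiI : i ∈ I <;> by_cases hjI : j ∈ I <;>
      simp only [hc, hiI, hjI] <;> norm_num
  rw [hsum]
  linarith

end Submodularity

lemma sum_split_sign {d : ℕ} (y m : Finset (Fin d) → ℝ) (hm : m ∅ = 0) :
    ∑ I ∈ univ.filter (fun I : Finset (Fin d) => I.Nonempty ∧ y I < 0), -(y I) * m I
        + ∑ I, y I * m I
      = ∑ I ∈ univ.filter (fun I : Finset (Fin d) => I.Nonempty ∧ 0 ≤ y I), y I * m I := by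
  rw [Finset.sum_filter, Finset.sum_filter, ← Finset.sum_add_distrib]
  refine Finset.sum_congr rfl fun I _ => ?_
  rcases I.eq_empty_or_nonempty with rfl | hI
  · simp [hm]
  · rcases lt_or_ge (y I) 0 with h | h
    · simp [hI, h, not_le.2 h]
    · simp [hI, h, not_lt.2 h]

theorem stmt0 (d : ℕ) (hd : 1 ≤ d) (y : Finset (Fin d) → ℝ) :
    (∃ R : Set (Fin d → ℝ), IsGenPerm R ∧
        (∑ I ∈ univ.filter (fun I : Finset (Fin d) => I.Nonempty ∧ y I < 0),
            (-(y I)) • stdSimp d I) + R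
          = ∑ I ∈ univ.filter (fun I : Finset (Fin d) => I.Nonempty ∧ 0 ≤ y I),
              y I • stdSimp d I)
    ↔ (∀ E T : Finset (Fin d), E.card = 2 → E ⊆ T →
        0 ≤ ∑ I ∈ univ.filter (fun I : Finset (Fin d) => E ⊆ I ∧ I ⊆ T), y I) := by
  have hneg : ∀ L : (Fin d → ℝ) →ₗ[ℝ] ℝ, _ := fun L => isGreatest_sum_stdSimp L (fun I => -(y I))
    (univ.filter fun I : Finset (Fin d) => I.Nonempty ∧ y I < 0) fun I hI =>
      ⟨(Finset.mem_filter.1 hI).2.1, neg_nonneg.2 (Finset.mem_filter.1 hI).2.2.le⟩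
  have hpos : ∀ L : (Fin d → ℝ) →ₗ[ℝ] ℝ, _ := fun L => isGreatest_sum_stdSimp L y
    (univ.filter fun I : Finset (Fin d) => I.Nonempty ∧ 0 ≤ y I) fun I hI =>
      (Finset.mem_filter.1 hI).2
  have hsplit := fun L => sum_split_sign y (maxVal (basisValues L)) (maxVal_empty _)
  constructor
  · rintro ⟨R, hR, hsum⟩
    refine hR.intervalNonneg fun L => ?_
    obtain ⟨c, hc⟩ := hR.1.exists_isGreatest hR.nonempty L
    have h := isGreatest_add (hneg L) hc
    rw [hsum] at h
    have := h.unique (hpos L)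
    rw [← hsplit L] at this
    rwa [← add_left_cancel this]
  · intro hy
    refine ⟨greedyPolytope y, isGenPerm_greedyPolytope hy, eq_of_isGreatest
      (convex_isCompact_add (convex_isCompact_sum_stdSimp _ _)
        (convex_isCompact_greedyPolytope y)) (convex_isCompact_sum_stdSimp _ _) fun L => ?_⟩
    refine ⟨_, isGreatest_add (hneg L) (isGreatest_greedyPolytope L hy), ?_⟩
    rw [hsplit L]
    exact hpos L
end

section
/- Let d ≥ 1 and let y : 2^{[d]} → ℝ be a function on subsets of [d] with y_∅ = 0, and define z : 2^{[d]} → ℝ by z_I = Σ_{J ⊆ I} y_J. Then the following are equivalent: (i) for every 2-element subset E ⊆ [d] and every T with E ⊆ T ⊆ [d], Σ_{I : E ⊆ I ⊆ T} y_I ≥ 0; (ii) z is supermodular, i.e., z_I + z_J ≤ z_{I∪J} + z_{I∩J} for all subsets I, J ⊆ [d]. -/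
open Finset

/-- The second difference of a set function at `S` in the directions `a`, `b` being nonnegative
implies monotonicity of its marginal increments. -/
theorem marginal_mono_of_local {α : Type*} [DecidableEq α] (z : Finset α → ℝ)
    (h : ∀ (S : Finset α) (a b : α), a ∉ S → b ∉ S → a ≠ b →
      z (insert a S) + z (insert b S) ≤ z (insert a (insert b S)) + z S)
    (S U : Finset α) (a : α) (ha : a ∉ S ∪ U) :
    z (insert a S) + z (S ∪ U) ≤ z (insert a (S ∪ U)) + z S := by
  induction U using Finset.induction_on with
  | empty => simp
  | insert b U hb ih =>
    rw [union_insert] at ha ⊢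
    simp only [mem_insert, not_or] at ha
    have h1 := ih ha.2
    by_cases hbS : b ∈ S ∪ U
    · rwa [insert_eq_self.2 hbS]
    · linarith [h (S ∪ U) a b ha.2 hbS ha.1]

/-- A set function satisfying the local supermodular inequalities is supermodular. -/
theorem supermodular_of_local {α : Type*} [DecidableEq α] (z : Finset α → ℝ)
    (h : ∀ (S : Finset α) (a b : α), a ∉ S → b ∉ S → a ≠ b →
      z (insert a S) + z (insert b S) ≤ z (insert a (insert b S)) + z S)
    (I J : Finset α) : z I + z J ≤ z (I ∪ J) + z (I ∩ J) := by
  have key : ∀ S U A : Finset α, Disjoint A (S ∪ U) →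
      z (S ∪ A) + z (S ∪ U) ≤ z (S ∪ A ∪ U) + z S := by
    intro S U A
    induction A using Finset.induction_on with
    | empty => intro _; simp [add_comm]
    | insert a A ha ih =>
      intro hA
      rw [disjoint_insert_left] at hA
      have h1 := ih hA.2
      have h2 := marginal_mono_of_local z h (S ∪ A) U a (by
        have := hA.1
        simp only [mem_union, not_or] at this ⊢
        exact ⟨⟨this.1, ha⟩, this.2⟩)
      rw [union_insert, insert_union]
      linarith
  have hk := key (I ∩ J) J (I \ J) (by
    rw [union_eq_right.2 inter_subset_right]
    exact sdiff_disjoint)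
  have e1 : I ∩ J ∪ I \ J = I := by grind
  rw [union_eq_right.2 (inter_subset_right : I ∩ J ⊆ J), e1] at hk
  exact hk

/-- The sum of `y` over the interval from `{a, b}` to `S ∪ {a, b}` is a second difference of the
subset sums of `y`. -/
theorem sum_Icc_pair_eq {α : Type*} [Fintype α] [DecidableEq α] (y z : Finset α → ℝ)
    (hz : ∀ I : Finset α, z I = ∑ J ∈ I.powerset, y J)
    (S : Finset α) (a b : α) (ha : a ∉ S) (hb : b ∉ S) (hab : a ≠ b) :
    ∑ I ∈ univ.filter (fun I : Finset α => {a, b} ⊆ I ∧ I ⊆ insert a (insert b S)), y I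
      = z (insert a (insert b S)) + z S - z (insert a S) - z (insert b S) := by
  have hz' : ∀ I, z I = ∑ J, if J ⊆ I then y J else 0 := by
    intro I
    rw [hz, ← sum_filter]
    congr 1
    ext J
    simp
  rw [sum_filter]
  simp only [hz']
  rw [← sum_add_distrib, ← sum_sub_distrib, ← sum_sub_distrib]
  refine sum_congr rfl fun J _ => ?_
  have e1 : J ⊆ S ↔ J ⊆ insert a (insert b S) ∧ a ∉ J ∧ b ∉ J := by grind
  have e2 : J ⊆ insert a S ↔ J ⊆ insert a (insert b S) ∧ b ∉ J := by grind
  have e3 : J ⊆ insert b S ↔ J ⊆ insert a (insert b S) ∧ a ∉ J := by grind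
  have e4 : {a, b} ⊆ J ↔ a ∈ J ∧ b ∈ J := by simp [insert_subset_iff]
  simp only [e1, e2, e3, e4]
  by_cases h1 : J ⊆ insert a (insert b S) <;> by_cases h2 : a ∈ J <;> by_cases h3 : b ∈ J <;>
    simp [h1, h2, h3]

theorem stmt1 (d : ℕ) (hd : 1 ≤ d) (y : Finset (Fin d) → ℝ) (hy : y ∅ = 0)
    (z : Finset (Fin d) → ℝ) (hz : ∀ I : Finset (Fin d), z I = ∑ J ∈ I.powerset, y J) :
    (∀ E T : Finset (Fin d), E.card = 2 → E ⊆ T →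
        0 ≤ ∑ I ∈ univ.filter (fun I : Finset (Fin d) => E ⊆ I ∧ I ⊆ T), y I)
    ↔ (∀ I J : Finset (Fin d), z I + z J ≤ z (I ∪ J) + z (I ∩ J)) := by
  constructor
  · intro h
    refine supermodular_of_local z fun S a b ha hb hab => ?_
    have h1 := h {a, b} (insert a (insert b S)) (card_pair hab) (by grind)
    rw [sum_Icc_pair_eq y z hz S a b ha hb hab] at h1
    linarith
  · intro h E T hE hET
    obtain ⟨a, b, hab, rfl⟩ := card_eq_two.1 hE
    obtain ⟨S, ha, hb, rfl⟩ : ∃ S, a ∉ S ∧ b ∉ S ∧ T = insert a (insert b S) :=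
      ⟨T \ {a, b}, by simp, by simp, by grind⟩
    rw [sum_Icc_pair_eq y z hz S a b ha hb hab]
    have h1 := h (insert a S) (insert b S)
    have e1 : insert a S ∪ insert b S = insert a (insert b S) := by grind
    have e2 : insert a S ∩ insert b S = S := by grind
    rw [e1, e2] at h1
    linarith
end

section
/- Fix d ≥ 2 and a pair (E, T) with E ⊆ T ⊆ [d] and |E| = 2. Suppose c is a family of nonnegative reals indexed by all pairs (E', T') with E' ⊆ T' ⊆ [d] and |E'| = 2 such that for every nonempty subset I ⊆ [d], the indicator [E ⊆ I ⊆ T] equals Σ_{(E',T')} c_{E'}^{T'}·[E' ⊆ I ⊆ T']. Then c_E^T = 1 and c_{E'}^{T'} = 0 for all (E', T') ≠ (E, T). (In other words, none of the functionals v_E^T, defined on simplices by v_E^T(Δ_I) = [E ⊆ I ⊆ T], is a nonnegative combination of the others; they are the extreme rays of the cone of positive translation-invariant Minkowski linear functionals.) -/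
open Finset

theorem stmt3 (d : ℕ) (hd : 2 ≤ d) (E T : Finset (Fin d)) (hE : E.card = 2) (hET : E ⊆ T)
    (c : Finset (Fin d) → Finset (Fin d) → ℝ)
    (hc : ∀ E' T' : Finset (Fin d), E'.card = 2 → E' ⊆ T' → 0 ≤ c E' T')
    (heq : ∀ I : Finset (Fin d), I.Nonempty →
      (if E ⊆ I ∧ I ⊆ T then (1 : ℝ) else 0) =
        ∑ p ∈ (univ ×ˢ univ).filter
            (fun p : Finset (Fin d) × Finset (Fin d) => p.1.card = 2 ∧ p.1 ⊆ p.2),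
          c p.1 p.2 * (if p.1 ⊆ I ∧ I ⊆ p.2 then (1 : ℝ) else 0)) :
    c E T = 1 ∧
      ∀ E' T' : Finset (Fin d), E'.card = 2 → E' ⊆ T' → (E', T') ≠ (E, T) → c E' T' = 0 := by
  have hnn : ∀ I : Finset (Fin d), ∀ p ∈ (univ ×ˢ univ).filter
      (fun p : Finset (Fin d) × Finset (Fin d) => p.1.card = 2 ∧ p.1 ⊆ p.2),
      0 ≤ c p.1 p.2 * (if p.1 ⊆ I ∧ I ⊆ p.2 then (1 : ℝ) else 0) := by
    intro I p hp
    obtain ⟨-, h2, hsub⟩ := mem_filter.1 hp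
    exact mul_nonneg (hc _ _ h2 hsub) (by split_ifs <;> norm_num)
  have hvanish : ∀ E' T' I : Finset (Fin d), E'.card = 2 → E' ⊆ I → I ⊆ T' →
      ¬(E ⊆ I ∧ I ⊆ T) → c E' T' = 0 := by
    intro E' T' I h2 hEI hIT hI
    have hne : I.Nonempty := (card_pos.1 (by omega : 0 < E'.card)).mono hEI
    have h := heq I hne
    rw [if_neg hI, eq_comm, sum_eq_zero_iff_of_nonneg (hnn I)] at h
    simpa [hEI, hIT] using h (E', T') (by simp [h2, hEI.trans hIT])
  have hsupp : ∀ E' T' : Finset (Fin d), E'.card = 2 → E' ⊆ T' →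
      ¬(E' = E ∧ T' ⊆ T) → c E' T' = 0 := by
    intro E' T' h2 hsub hne
    by_cases h : E ⊆ E'
    · have hEE : E = E' := eq_of_subset_of_card_le h (by omega)
      exact hvanish E' T' T' h2 hsub subset_rfl fun hT => hne ⟨hEE.symm, hT.2⟩
    · exact hvanish E' T' E' h2 subset_rfl hsub fun hE' => h hE'.1
  have hE0 : E.Nonempty := card_pos.1 (by omega)
  have hone : c E T = 1 := by
    have h := heq T (hE0.mono hET)
    rw [if_pos ⟨hET, subset_rfl⟩, sum_eq_single_of_mem (E, T) (by simp [hE, hET])] at h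
    · simpa [hET] using h.symm
    · rintro ⟨E', T'⟩ hp hne
      obtain ⟨-, h2, hsub⟩ := mem_filter.1 hp
      by_cases hT : T ⊆ T'
      · rw [hsupp E' T' h2 hsub, zero_mul]
        rintro ⟨rfl, hT'⟩
        exact hne (Prod.ext rfl (hT'.antisymm hT))
      · simp [hT]
  refine ⟨hone, fun E' T' h2 hsub hne => ?_⟩
  by_cases hs : E' = E ∧ T' ⊆ T
  · obtain ⟨rfl, -⟩ := hs
    have h := heq E' hE0
    have hmem : (E', T) ∈ (univ ×ˢ univ).filter
        (fun p : Finset (Fin d) × Finset (Fin d) => p.1.card = 2 ∧ p.1 ⊆ p.2) := by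
      simp [hE, hET]
    rw [if_pos ⟨subset_rfl, hET⟩, ← add_sum_erase _ _ hmem, if_pos ⟨subset_rfl, hET⟩, hone,
      mul_one, left_eq_add,
      sum_eq_zero_iff_of_nonneg fun p hp => hnn E' p (mem_of_mem_erase hp)] at h
    simpa [hsub] using h (E', T') (mem_erase.2 ⟨hne, by simp [h2, hsub]⟩)
  · exact hsupp E' T' h2 hsub hs
end

section
/- Let d ≥ 2, let E = {i, j} ⊆ T ⊆ [d] with i ≠ j, and let u ∈ ℝ^d be compatible with (E, T), meaning: u_i = u_j, the remaining coordinates u_k (k ∉ {i,j}) are pairwise distinct and distinct from u_i, and min_{k ∉ T} u_k > u_i = u_j > max_{k ∈ T∖E} u_k. Then for every generalized permutahedron P ⊆ ℝ^d, the face P^u = {x ∈ P : ⟨u, x⟩ = max_{y∈P} ⟨u, y⟩} is a translate of λ·[e_i, e_j] for a unique real λ ≥ 0 (i.e., P^u is a point or a segment in direction e_i − e_j). Moreover, if y is a vector of reals indexed by nonempty subsets of [d] such that Σ_{I : E'⊆I⊆T'} y_I ≥ 0 for all 2-element E' ⊆ T' ⊆ [d], and P is the generalized permutahedron with P + Σ_{I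 : y_I<0}(−y_I)·Δ_I = Σ_{I : y_I≥0} y_I·Δ_I, then λ = Σ_{I : E ⊆ I ⊆ T} y_I. -/
open Finset Pointwise

/-- The face of `P` in direction `u`: points of `P` maximizing `⟨u, ·⟩`. -/
def faceIn {d : ℕ} (P : Set (Fin d → ℝ)) (u : Fin d → ℝ) : Set (Fin d → ℝ) :=
  {x ∈ P | ∀ y ∈ P, ∑ k, u k * y k ≤ ∑ k, u k * x k}

theorem mem_faceIn {d : ℕ} {P : Set (Fin d → ℝ)} {u x : Fin d → ℝ} :
    x ∈ faceIn P u ↔ x ∈ P ∧ ∀ y ∈ P, u ⬝ᵥ y ≤ u ⬝ᵥ x := Iff.rfl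

theorem faceIn_add {d : ℕ} (P Q : Set (Fin d → ℝ)) (u : Fin d → ℝ) :
    faceIn (P + Q) u = faceIn P u + faceIn Q u := by
  ext x
  constructor
  · rintro ⟨⟨p, hp, q, hq, rfl⟩, hmax⟩
    refine ⟨p, mem_faceIn.2 ⟨hp, fun y hy => ?_⟩, q, mem_faceIn.2 ⟨hq, fun y hy => ?_⟩, rfl⟩
    · have h : u ⬝ᵥ (y + q) ≤ u ⬝ᵥ (p + q) := hmax _ (Set.add_mem_add hy hq)
      simpa [dotProduct_add] using h
    · have h : u ⬝ᵥ (p + y) ≤ u ⬝ᵥ (p + q) := hmax _ (Set.add_mem_add hp hy)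
      simpa [dotProduct_add] using h
  · rintro ⟨p, hp, q, hq, rfl⟩
    rw [mem_faceIn] at hp hq
    refine mem_faceIn.2 ⟨Set.add_mem_add hp.1 hq.1, ?_⟩
    rintro _ ⟨a, ha, b, hb, rfl⟩
    simpa [dotProduct_add] using add_le_add (hp.2 a ha) (hq.2 b hb)

theorem faceIn_zero {d : ℕ} (u : Fin d → ℝ) : faceIn (0 : Set (Fin d → ℝ)) u = 0 := by
  ext x
  rw [mem_faceIn]
  constructor
  · exact fun h => h.1
  · intro h
    refine ⟨h, fun y hy => ?_⟩
    rw [Set.mem_zero] at h hy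
    rw [h, hy]

theorem faceIn_sum {d : ℕ} {ι : Type*} (s : Finset ι) (P : ι → Set (Fin d → ℝ))
    (u : Fin d → ℝ) : faceIn (∑ a ∈ s, P a) u = ∑ a ∈ s, faceIn (P a) u := by
  classical
  induction s using Finset.induction_on with
  | empty => simpa using faceIn_zero u
  | insert a s ha ih => rw [sum_insert ha, sum_insert ha, faceIn_add, ih]

theorem faceIn_smul {d : ℕ} {c : ℝ} (hc : 0 < c) (P : Set (Fin d → ℝ)) (u : Fin d → ℝ) :
    faceIn (c • P) u = c • faceIn P u := by
  ext x
  constructor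
  · rintro ⟨⟨p, hp, rfl⟩, hmax⟩
    refine ⟨p, mem_faceIn.2 ⟨hp, fun y hy => ?_⟩, rfl⟩
    have h : u ⬝ᵥ (c • y) ≤ u ⬝ᵥ (c • p) := hmax _ (Set.smul_mem_smul_set hy)
    simpa [dotProduct_smul, hc] using h
  · rintro ⟨p, hp, rfl⟩
    rw [mem_faceIn] at hp
    refine mem_faceIn.2 ⟨Set.smul_mem_smul_set hp.1, ?_⟩
    rintro _ ⟨a, ha, rfl⟩
    simpa [dotProduct_smul, hc] using hp.2 a ha

theorem faceIn_smul_of_nonneg {d : ℕ} {c : ℝ} (hc : 0 ≤ c) {P : Set (Fin d → ℝ)}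
    {u : Fin d → ℝ} (hP : (faceIn P u).Nonempty) : faceIn (c • P) u = c • faceIn P u := by
  rcases hc.eq_or_lt with rfl | hc
  · rw [Set.zero_smul_set hP, Set.zero_smul_set (hP.mono fun x hx => hx.1), faceIn_zero]
  · exact faceIn_smul hc P u

theorem Convex.faceIn {d : ℕ} {P : Set (Fin d → ℝ)} (hP : Convex ℝ P) (u : Fin d → ℝ) :
    Convex ℝ (faceIn P u) := by
  intro x hx y hy a b ha hb hab
  rw [mem_faceIn] at hx hy
  refine mem_faceIn.2 ⟨hP hx.1 hy.1 ha hb hab, fun z hz => ?_⟩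
  have h1 := mul_le_mul_of_nonneg_left (hx.2 z hz) ha
  have h2 := mul_le_mul_of_nonneg_left (hy.2 z hz) hb
  have h3 : u ⬝ᵥ z = a * (u ⬝ᵥ z) + b * (u ⬝ᵥ z) := by rw [← add_mul, hab, one_mul]
  simp only [dotProduct_add, dotProduct_smul, smul_eq_mul]
  linarith

theorem dotProduct_le_of_mem_convexHull {d : ℕ} {V : Set (Fin d → ℝ)} {u y : Fin d → ℝ} {c : ℝ}
    (hV : ∀ v ∈ V, u ⬝ᵥ v ≤ c) (hy : y ∈ convexHull ℝ V) : u ⬝ᵥ y ≤ c := by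
  refine convexHull_min (t := {v | u ⬝ᵥ v ≤ c}) hV ?_ hy
  exact convex_halfSpace_le ⟨dotProduct_add u, fun a x => dotProduct_smul a u x⟩ c

/-- A face of a convex hull is the convex hull of the maximizing generators. -/
theorem faceIn_convexHull {d : ℕ} (V : Set (Fin d → ℝ)) (u : Fin d → ℝ) :
    faceIn (convexHull ℝ V) u = convexHull ℝ (faceIn V u) := by
  apply Set.Subset.antisymm
  · intro x hx
    rw [mem_faceIn] at hx
    obtain ⟨hx, hmax⟩ := hx
    have hx' := hx
    rw [_root_.convexHull_eq] at hx'
    obtain ⟨ι, t, w, z, hw, hw1, hz, hxz⟩ := hx'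
    have hsum : ∑ a ∈ t, w a * (u ⬝ᵥ x - u ⬝ᵥ z a) = 0 := by
      have hux : u ⬝ᵥ x = ∑ a ∈ t, w a * (u ⬝ᵥ z a) := by
        rw [← hxz, centerMass_eq_of_sum_1 _ _ hw1, dotProduct_sum]
        simp only [dotProduct_smul, smul_eq_mul]
      simp only [mul_sub, sum_sub_distrib, ← sum_mul, hw1, ← hux, one_mul, sub_self]
    rw [sum_eq_zero_iff_of_nonneg fun a ha => mul_nonneg (hw a ha)
      (sub_nonneg.2 (hmax _ (subset_convexHull ℝ V (hz a ha))))] at hsum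
    classical
    rw [← hxz, ← centerMass_filter_ne_zero]
    refine centerMass_mem_convexHull _ (fun a ha => hw a (mem_filter.1 ha).1) ?_ fun a ha => ?_
    · rw [sum_filter_ne_zero, hw1]
      exact one_pos
    · obtain ⟨ha, hne⟩ := mem_filter.1 ha
      have hxa : u ⬝ᵥ x = u ⬝ᵥ z a :=
        sub_eq_zero.1 ((mul_eq_zero.1 (hsum a ha)).resolve_left hne)
      exact mem_faceIn.2 ⟨hz a ha, fun y hy => hxa ▸ hmax y (subset_convexHull ℝ V hy)⟩
  · refine convexHull_min (fun z hz => ?_) ((convex_convexHull ℝ V).faceIn u)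
    rw [mem_faceIn] at hz
    exact mem_faceIn.2 ⟨subset_convexHull ℝ V hz.1,
      fun y hy => dotProduct_le_of_mem_convexHull hz.2 hy⟩

theorem sum_singleton_add_smul {d : ℕ} {ι : Type*} (s : Finset ι) {S : Set (Fin d → ℝ)}
    (hS : Convex ℝ S) (hne : S.Nonempty) (F : ι → Set (Fin d → ℝ)) (a : ι → ℝ)
    (ha : ∀ k ∈ s, 0 ≤ a k) (hF : ∀ k ∈ s, ∃ t, F k = {t} + a k • S) :
    ∃ t, ∑ k ∈ s, F k = {t} + (∑ k ∈ s, a k) • S := by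
  classical
  induction s using Finset.induction_on with
  | empty => exact ⟨0, by simp [Set.zero_smul_set hne, Set.singleton_zero]⟩
  | insert k s hk ih =>
    obtain ⟨t, ht⟩ := ih (fun l hl => ha l (mem_insert_of_mem hl))
      (fun l hl => hF l (mem_insert_of_mem hl))
    obtain ⟨t', ht'⟩ := hF k (mem_insert_self k s)
    refine ⟨t' + t, ?_⟩
    rw [sum_insert hk, sum_insert hk, ht, ht', hS.add_smul (ha k (mem_insert_self k s))
      (sum_nonneg fun l hl => ha l (mem_insert_of_mem hl)), ← Set.singleton_add_singleton,
      add_add_add_comm]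

theorem singleton_add_smul_segment {d : ℕ} (t v w : Fin d → ℝ) (a : ℝ) :
    {t} + a • segment ℝ v w = segment ℝ (t + a • v) (t + a • w) := by
  rw [Set.singleton_add, segment_eq_image_lineMap, segment_eq_image_lineMap]
  ext x
  simp only [← Set.image_smul, Set.image_image, AffineMap.lineMap_apply_module]
  have : ∀ r : ℝ, t + a • ((1 - r) • v + r • w) = (1 - r) • (t + a • v) + r • (t + a • w) := by
    intro r
    module
  simp only [this]

theorem bounds_of_mem_translate {d : ℕ} {i j : Fin d} (hij : i ≠ j) {t x : Fin d → ℝ} {a : ℝ}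
    (ha : 0 ≤ a)
    (hx : x ∈ {t} + a • segment ℝ (Pi.single i 1 : Fin d → ℝ) (Pi.single j 1)) :
    t i ≤ x i ∧ x i ≤ t i + a := by
  rw [singleton_add_smul_segment] at hx
  obtain ⟨b, c, hb, hc, hbc, rfl⟩ := hx
  have hb1 : b ≤ 1 := by linarith
  have h : (b • (t + a • (Pi.single i 1 : Fin d → ℝ)) + c • (t + a • Pi.single j 1) : Fin d → ℝ) i
      = t i + b * a := by
    simp [Pi.single_eq_of_ne hij]
    linear_combination (t i) * hbc
  rw [h]
  constructor <;> nlinarith [mul_nonneg hb ha]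

theorem translate_smul_segment_inj {d : ℕ} {i j : Fin d} (hij : i ≠ j) {t t' : Fin d → ℝ}
    {a b : ℝ} (ha : 0 ≤ a) (hb : 0 ≤ b)
    (h : {t} + a • segment ℝ (Pi.single i 1 : Fin d → ℝ) (Pi.single j 1)
      = {t'} + b • segment ℝ (Pi.single i 1 : Fin d → ℝ) (Pi.single j 1)) : a = b := by
  have key : ∀ {t t' : Fin d → ℝ} {a b : ℝ}, 0 ≤ b →
      {t} + a • segment ℝ (Pi.single i 1 : Fin d → ℝ) (Pi.single j 1)
      = {t'} + b • segment ℝ (Pi.single i 1 : Fin d → ℝ) (Pi.single j 1) →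
      t' i ≤ t i ∧ t i + a ≤ t' i + b := by
    intro t t' a b hb h
    have h1 : t + a • (Pi.single i 1 : Fin d → ℝ) ∈
        {t} + a • segment ℝ (Pi.single i 1 : Fin d → ℝ) (Pi.single j 1) := by
      rw [singleton_add_smul_segment]
      exact left_mem_segment _ _ _
    have h2 : t + a • (Pi.single j 1 : Fin d → ℝ) ∈
        {t} + a • segment ℝ (Pi.single i 1 : Fin d → ℝ) (Pi.single j 1) := by
      rw [singleton_add_smul_segment]
      exact right_mem_segment _ _ _
    rw [h] at h1 h2
    have h1 := (bounds_of_mem_translate hij hb h1).2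
    have h2 := (bounds_of_mem_translate hij hb h2).1
    simp [Pi.single_eq_of_ne hij] at h1 h2
    exact ⟨h2, h1⟩
  have h1 := key hb h
  have h2 := key ha h.symm
  linarith [h1.1, h1.2, h2.1, h2.2]

theorem faceIn_stdSimp {d : ℕ} (I : Finset (Fin d)) (u : Fin d → ℝ) :
    faceIn (stdSimp d I) u = convexHull ℝ
      ((fun k => (Pi.single k 1 : Fin d → ℝ)) '' {k | k ∈ I ∧ ∀ l ∈ I, u l ≤ u k}) := by
  rw [stdSimp, faceIn_convexHull]
  congr 1
  ext x
  rw [mem_faceIn]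
  constructor
  · rintro ⟨⟨k, hk, rfl⟩, hmax⟩
    refine ⟨k, ⟨hk, fun l hl => ?_⟩, rfl⟩
    simpa using hmax _ ⟨l, hl, rfl⟩
  · rintro ⟨k, ⟨hk, hmax⟩, rfl⟩
    refine ⟨⟨k, hk, rfl⟩, ?_⟩
    rintro _ ⟨l, hl, rfl⟩
    simpa using hmax l hl

/-- If `u k < u l`, a permutation maximizing `u` on the permutahedron has `σ k < σ l`. -/
theorem lt_of_mem_faceIn_perm {d : ℕ} {u : Fin d → ℝ} {σ : Equiv.Perm (Fin d)}
    (hσ : ∀ τ : Equiv.Perm (Fin d), (u ⬝ᵥ fun k => ((τ k : ℕ) + 1 : ℝ)) ≤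
      u ⬝ᵥ fun k => ((σ k : ℕ) + 1 : ℝ)) {k l : Fin d} (hkl : u k < u l) : σ k < σ l := by
  by_contra! hle
  have hne : k ≠ l := by rintro rfl; exact lt_irrefl _ hkl
  have hlt : σ l < σ k := lt_of_le_of_ne hle fun h => hne (σ.injective h).symm
  have hlt' : ((σ l : ℕ) : ℝ) < ((σ k : ℕ) : ℝ) := by exact_mod_cast hlt
  have heq : (fun m => (((Equiv.swap k l).trans σ m : ℕ) + 1 : ℝ)) =
      (fun m => ((σ m : ℕ) + 1 : ℝ)) + (((σ k : ℕ) : ℝ) - (σ l : ℕ)) •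
        ((Pi.single l 1 : Fin d → ℝ) - Pi.single k 1) := by
    funext m
    by_cases hmk : m = k
    · subst hmk
      simp [Pi.single_eq_of_ne hne]
      ring
    · by_cases hml : m = l
      · subst hml
        simp [Pi.single_eq_of_ne hmk]
        ring
      · simp [Equiv.swap_apply_of_ne_of_ne hmk hml, Pi.single_eq_of_ne hmk,
          Pi.single_eq_of_ne hml]
  have h := hσ ((Equiv.swap k l).trans σ)
  rw [heq, dotProduct_add, dotProduct_smul, dotProduct_sub, dotProduct_single,
    dotProduct_single, smul_eq_mul] at h
  nlinarith [mul_pos (sub_pos.2 hlt') (sub_pos.2 hkl)]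

theorem coe_perm_eq_card {d : ℕ} (σ : Equiv.Perm (Fin d)) (k : Fin d) :
    (σ k : ℕ) = #{l | σ l < σ k} := by
  have : (univ.filter fun l => σ l < σ k) = (Iio (σ k)).map σ.symm.toEmbedding := by
    ext l
    simp [Finset.mem_map_equiv]
  rw [this, card_map, Fin.card_Iio]

theorem mem_faceIn_permutahedron {d : ℕ} {i j : Fin d} {u : Fin d → ℝ}
    (hu : ∀ k l : Fin d, k ≠ i → k ≠ j → l ≠ k → u l ≠ u k) {x : Fin d → ℝ}
    (hx : x ∈ faceIn (permutahedron d) u) :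
    (∀ k, k ≠ i → k ≠ j → x k = #{l | u l < u k} + 1) ∧
      ∑ k, x k = ∑ k : Fin d, ((k : ℕ) + 1 : ℝ) := by
  rw [permutahedron, faceIn_convexHull] at hx
  refine convexHull_min (t := {x : Fin d → ℝ | (∀ k, k ≠ i → k ≠ j →
    x k = #{l | u l < u k} + 1) ∧ ∑ k, x k = ∑ k : Fin d, ((k : ℕ) + 1 : ℝ)}) ?_ ?_ hx
  · rintro _ ⟨⟨σ, rfl⟩, hmax⟩
    have hσ : ∀ τ : Equiv.Perm (Fin d), (u ⬝ᵥ fun k => ((τ k : ℕ) + 1 : ℝ)) ≤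
      u ⬝ᵥ fun k => ((σ k : ℕ) + 1 : ℝ) := fun τ => hmax _ ⟨τ, rfl⟩
    refine ⟨fun k hki hkj => ?_, Equiv.sum_comp σ fun k : Fin d => ((k : ℕ) + 1 : ℝ)⟩
    have : (univ.filter fun l => σ l < σ k) = univ.filter fun l => u l < u k := by
      refine filter_congr fun l _ => ⟨fun h => ?_, lt_of_mem_faceIn_perm hσ⟩
      have hlk : l ≠ k := by rintro rfl; exact lt_irrefl _ h
      rcases (hu k l hki hkj hlk).lt_or_gt with h' | h'
      · exact h'
      · exact absurd (lt_of_mem_faceIn_perm hσ h') h.not_gt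
    simp only [coe_perm_eq_card σ k, this]
  · rintro x ⟨hx, hx'⟩ y ⟨hy, hy'⟩ a b ha hb hab
    refine ⟨fun k hki hkj => ?_, ?_⟩
    · simp only [Pi.add_apply, Pi.smul_apply, smul_eq_mul, hx k hki hkj, hy k hki hkj]
      rw [← add_mul, hab, one_mul]
    · simp only [Pi.add_apply, Pi.smul_apply, smul_eq_mul, sum_add_distrib, ← mul_sum, hx', hy']
      rw [← add_mul, hab, one_mul]

/-- The `u`-face of a generalized permutahedron lies in a line of direction `e_i - e_j`. -/
theorem sub_eq_smul_of_mem_faceIn {d : ℕ} {i j : Fin d} (hij : i ≠ j) {u : Fin d → ℝ}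
    (hu : ∀ k l : Fin d, k ≠ i → k ≠ j → l ≠ k → u l ≠ u k) {P Q : Set (Fin d → ℝ)} {c : ℝ}
    (hc : 0 < c) (hPQ : P + Q = c • permutahedron d) (hQ : (faceIn Q u).Nonempty)
    {x y : Fin d → ℝ} (hx : x ∈ faceIn P u) (hy : y ∈ faceIn P u) :
    x - y = (x i - y i) • ((Pi.single i 1 : Fin d → ℝ) - Pi.single j 1) := by
  obtain ⟨q, hq⟩ := hQ
  have hface : faceIn P u + faceIn Q u = c • faceIn (permutahedron d) u := by
    rw [← faceIn_add, hPQ, faceIn_smul hc]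
  obtain ⟨a, ha, hax⟩ : x + q ∈ c • faceIn (permutahedron d) u :=
    hface ▸ Set.add_mem_add hx hq
  obtain ⟨b, hb, hby⟩ : y + q ∈ c • faceIn (permutahedron d) u :=
    hface ▸ Set.add_mem_add hy hq
  have ha := mem_faceIn_permutahedron hu ha
  have hb := mem_faceIn_permutahedron hu hb
  have hxy : x - y = c • (a - b) := by
    have hax : c • a = x + q := hax
    have hby : c • b = y + q := hby
    rw [smul_sub, hax, hby]
    abel
  have hzero : ∀ k, k ≠ i → k ≠ j → (a - b) k = 0 := fun k hi hj => by
    rw [Pi.sub_apply, ha.1 k hi hj, hb.1 k hi hj, sub_self]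
  have hsum : (a - b) i + (a - b) j = 0 := by
    rw [← Fintype.sum_eq_add i j hij fun k hk => hzero k hk.1 hk.2]
    simp only [Pi.sub_apply, sum_sub_distrib, ha.2, hb.2, sub_self]
  rw [← Pi.sub_apply, hxy]
  funext k
  by_cases hki : k = i
  · subst hki
    simp [Pi.single_eq_of_ne hij]
  · by_cases hkj : k = j
    · subst hkj
      simp only [Pi.smul_apply, Pi.sub_apply, smul_eq_mul, Pi.single_eq_same,
        Pi.single_eq_of_ne hki] at hsum ⊢
      linear_combination c * hsum
    · have := hzero k hki hkj
      simp only [Pi.smul_apply, this]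
      simp [Pi.single_eq_of_ne hki, Pi.single_eq_of_ne hkj]

theorem continuous_dotProduct_left {d : ℕ} (u : Fin d → ℝ) :
    Continuous fun x : Fin d → ℝ => u ⬝ᵥ x := by
  fun_prop

theorem IsPolytope.isCompact {d : ℕ} {P : Set (Fin d → ℝ)} (hP : IsPolytope P) :
    IsCompact P := by
  obtain ⟨S, rfl⟩ := hP
  exact S.finite_toSet.isCompact_convexHull (𝕜 := ℝ)

theorem IsPolytope.convex {d : ℕ} {P : Set (Fin d → ℝ)} (hP : IsPolytope P) : Convex ℝ P := by
  obtain ⟨S, rfl⟩ := hP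
  exact convex_convexHull ℝ _

theorem IsCompact.faceIn_nonempty {d : ℕ} {P : Set (Fin d → ℝ)} (hP : IsCompact P)
    (hne : P.Nonempty) (u : Fin d → ℝ) : (faceIn P u).Nonempty := by
  obtain ⟨x, hx, hmax⟩ := hP.exists_isMaxOn hne (continuous_dotProduct_left u).continuousOn
  exact ⟨x, hx, fun y hy => hmax hy⟩

theorem IsCompact.faceIn {d : ℕ} {P : Set (Fin d → ℝ)} (hP : IsCompact P) (u : Fin d → ℝ) :
    IsCompact (faceIn P u) := by
  have : _root_.faceIn P u = P ∩ ⋂ y ∈ P, {x | u ⬝ᵥ y ≤ u ⬝ᵥ x} := by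
    ext x
    simp [mem_faceIn]
  rw [this]
  exact hP.inter_right (isClosed_biInter fun y _ =>
    isClosed_le continuous_const (continuous_dotProduct_left u))

/-- A compact convex nonempty set inside a line of direction `e_i - e_j` is a translate of a
dilated segment. -/
theorem eq_translate_smul_segment {d : ℕ} {i j : Fin d} {F : Set (Fin d → ℝ)}
    (hF : IsCompact F) (hconv : Convex ℝ F) (hne : F.Nonempty)
    (hline : ∀ x ∈ F, ∀ y ∈ F,
      x - y = (x i - y i) • ((Pi.single i 1 : Fin d → ℝ) - Pi.single j 1)) :
    ∃ a : ℝ, 0 ≤ a ∧ ∃ t : Fin d → ℝ,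
      F = {t} + a • segment ℝ (Pi.single i 1 : Fin d → ℝ) (Pi.single j 1) := by
  obtain ⟨y, hy, hmin⟩ := hF.exists_isMinOn hne (continuous_apply i).continuousOn
  obtain ⟨z, hz, hmax⟩ := hF.exists_isMaxOn hne (continuous_apply i).continuousOn
  have hyz : 0 ≤ z i - y i := sub_nonneg.2 (hmin hz)
  refine ⟨z i - y i, hyz, y - (z i - y i) • Pi.single j 1, ?_⟩
  have hzy : y - (z i - y i) • Pi.single j 1 + (z i - y i) • (Pi.single i 1 : Fin d → ℝ) = z := by
    have := hline z hz y hy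
    rw [smul_sub] at this
    rw [sub_add_eq_add_sub, add_sub_assoc, ← this, add_sub_cancel]
  rw [singleton_add_smul_segment, hzy, sub_add_cancel]
  refine Set.Subset.antisymm (fun x hx => ?_) (hconv.segment_subset hz hy)
  have hxy : x i - y i ≤ z i - y i := sub_le_sub_right (hmax hx) _
  have hxy0 : 0 ≤ x i - y i := sub_nonneg.2 (hmin hx)
  rcases hyz.eq_or_lt with h0 | hpos
  · have hx0 : x i - y i = 0 := by linarith
    have := hline x hx y hy
    rw [hx0, zero_smul, sub_eq_zero] at this
    rw [this]
    exact right_mem_segment _ _ _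
  · rw [segment_symm, segment_eq_image']
    refine ⟨(x i - y i) / (z i - y i), ⟨by positivity, (div_le_one hpos).2 hxy⟩, ?_⟩
    simp only
    rw [hline z hz y hy, smul_smul, div_mul_cancel₀ _ hpos.ne', ← hline x hx y hy,
      add_sub_cancel]

theorem faceIn_stdSimp_of_subset {d : ℕ} {i j : Fin d} {I T : Finset (Fin d)} {u : Fin d → ℝ}
    (hu : u i = u j)
    (hlt : ∀ k : Fin d, k ∈ T \ ({i, j} : Finset (Fin d)) → u k < u i)
    (hI : {i, j} ⊆ I) (hIT : I ⊆ T) :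
    faceIn (stdSimp d I) u = segment ℝ (Pi.single i 1 : Fin d → ℝ) (Pi.single j 1) := by
  have hle : ∀ l ∈ I, u l ≤ u i := fun l hl => by
    by_cases h : l ∈ ({i, j} : Finset (Fin d))
    · rcases mem_insert.1 h with rfl | h
      · exact le_rfl
      · rw [mem_singleton.1 h, hu]
    · exact (hlt l (mem_sdiff.2 ⟨hIT hl, h⟩)).le
  have hset : {k | k ∈ I ∧ ∀ l ∈ I, u l ≤ u k} = {i, j} := by
    ext k
    constructor
    · rintro ⟨hk, hmax⟩
      by_contra h
      exact (hlt k (mem_sdiff.2 ⟨hIT hk, by simpa using h⟩)).not_ge (hmax i (hI (by simp)))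
    · rintro (rfl | rfl)
      · exact ⟨hI (by simp), hle⟩
      · exact ⟨hI (by simp), fun l hl => hu ▸ hle l hl⟩
  rw [faceIn_stdSimp, hset, Set.image_pair, convexHull_pair]

theorem faceIn_stdSimp_of_not_subset {d : ℕ} {i j : Fin d} {I T : Finset (Fin d)}
    {u : Fin d → ℝ} (hij : u i = u j)
    (hu : ∀ k l : Fin d, k ≠ i → k ≠ j → l ≠ k → u l ≠ u k)
    (hlt : ∀ k : Fin d, k ∉ T → u i < u k) (hne : I.Nonempty)
    (hI : ¬ ({i, j} ⊆ I ∧ I ⊆ T)) :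
    ∃ k, faceIn (stdSimp d I) u = {Pi.single k 1} := by
  obtain ⟨k, hk, hmax⟩ := exists_max_image I u hne
  refine ⟨k, ?_⟩
  have hset : {k | k ∈ I ∧ ∀ l ∈ I, u l ≤ u k} = {k} := by
    ext l
    refine ⟨?_, by rintro rfl; exact ⟨hk, hmax⟩⟩
    rintro ⟨hl, hlmax⟩
    by_contra hlk
    have hlk : l ≠ k := hlk
    have heq : u l = u k := le_antisymm (hmax l hl) (hlmax k hk)
    have hk' : k = i ∨ k = j := by
      by_contra! h
      exact hu k l h.1 h.2 hlk heq
    have hl' : l = i ∨ l = j := by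
      by_contra! h
      exact hu l k h.1 h.2 hlk.symm heq.symm
    have hki : u k = u i := by rcases hk' with rfl | rfl <;> simp [hij]
    refine hI ⟨?_, fun m hm => ?_⟩
    · rw [insert_subset_iff, singleton_subset_iff]
      rcases hk' with rfl | rfl <;> rcases hl' with rfl | rfl
      · exact absurd rfl hlk
      · exact ⟨hk, hl⟩
      · exact ⟨hl, hk⟩
      · exact absurd rfl hlk
    · by_contra hmT
      exact (hlt m hmT).not_ge (hki ▸ hmax m hm)
  rw [faceIn_stdSimp, hset, Set.image_singleton, convexHull_singleton]

theorem stmt4 (d : ℕ) (hd : 2 ≤ d) (i j : Fin d) (hij : i ≠ j) (T : Finset (Fin d))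
    (hET : ({i, j} : Finset (Fin d)) ⊆ T) (u : Fin d → ℝ)
    (hu1 : u i = u j)
    (hu2 : ∀ k l : Fin d, k ∉ ({i, j} : Finset (Fin d)) → l ∉ ({i, j} : Finset (Fin d)) →
      k ≠ l → u k ≠ u l)
    (hu3 : ∀ k : Fin d, k ∉ ({i, j} : Finset (Fin d)) → u k ≠ u i)
    (hu4 : ∀ k : Fin d, k ∉ T → u i < u k)
    (hu5 : ∀ k : Fin d, k ∈ T \ ({i, j} : Finset (Fin d)) → u k < u i) :
    (∀ P : Set (Fin d → ℝ), IsGenPerm P →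
      ∃! lam : ℝ, 0 ≤ lam ∧ ∃ t : Fin d → ℝ,
        faceIn P u = {t} + lam • segment ℝ (Pi.single i 1 : Fin d → ℝ) (Pi.single j 1))
    ∧ (∀ y : Finset (Fin d) → ℝ,
        (∀ E' T' : Finset (Fin d), E'.card = 2 → E' ⊆ T' →
          0 ≤ ∑ I ∈ univ.filter (fun I : Finset (Fin d) => E' ⊆ I ∧ I ⊆ T'), y I) →
        ∀ P : Set (Fin d → ℝ), IsGenPerm P →
          P + (∑ I ∈ univ.filter (fun I : Finset (Fin d) => I.Nonempty ∧ y I < 0),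
                (-(y I)) • stdSimp d I)
            = (∑ I ∈ univ.filter (fun I : Finset (Fin d) => I.Nonempty ∧ 0 ≤ y I),
                y I • stdSimp d I) →
          ∃ t : Fin d → ℝ,
            faceIn P u = {t} +
              (∑ I ∈ univ.filter
                  (fun I : Finset (Fin d) => ({i, j} : Finset (Fin d)) ⊆ I ∧ I ⊆ T), y I) •
                segment ℝ (Pi.single i 1 : Fin d → ℝ) (Pi.single j 1)) := by
  have hu : ∀ k l : Fin d, k ≠ i → k ≠ j → l ≠ k → u l ≠ u k := by
    intro k l hki hkj hlk
    have hk : k ∉ ({i, j} : Finset (Fin d)) := by simp [hki, hkj]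
    by_cases hl : l ∈ ({i, j} : Finset (Fin d))
    · have hli : u l = u i := by
        rcases mem_insert.1 hl with rfl | hl
        · rfl
        · rw [mem_singleton.1 hl, hu1]
      rw [hli]
      exact (hu3 k hk).symm
    · exact hu2 l k hl hk hlk
  have hface : ∀ P : Set (Fin d → ℝ), IsGenPerm P → ∃ a : ℝ, 0 ≤ a ∧ ∃ t : Fin d → ℝ,
      faceIn P u = {t} + a • segment ℝ (Pi.single i 1 : Fin d → ℝ) (Pi.single j 1) := by
    rintro P ⟨hP, c, hc, Q, hQ, hPQ⟩
    have hne : (P + Q).Nonempty := by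
      rw [hPQ]
      have hperm : (permutahedron d).Nonempty :=
        ⟨_, subset_convexHull ℝ _ ⟨Equiv.refl _, rfl⟩⟩
      exact hperm.smul_set
    exact eq_translate_smul_segment (hP.isCompact.faceIn u) (hP.convex.faceIn u)
      (hP.isCompact.faceIn_nonempty hne.of_add_left u) fun x hx y hy =>
        sub_eq_smul_of_mem_faceIn hij hu hc hPQ
          (hQ.isCompact.faceIn_nonempty hne.of_add_right u) hx hy
  refine ⟨fun P hP => ?_, fun y _ P hP hsum => ?_⟩
  · obtain ⟨a, ha, t, ht⟩ := hface P hP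
    refine ⟨a, ⟨ha, t, ht⟩, ?_⟩
    rintro b ⟨hb, t', ht'⟩
    exact translate_smul_segment_inj hij hb ha (ht'.symm.trans ht)
  · obtain ⟨a, ha, t, ht⟩ := hface P hP
    refine ⟨t, ?_⟩
    set S := segment ℝ (Pi.single i 1 : Fin d → ℝ) (Pi.single j 1) with hS
    have hSc : Convex ℝ S := convex_segment _ _
    have hSne : S.Nonempty := ⟨_, left_mem_segment _ _ _⟩
    let δ : Finset (Fin d) → ℝ := fun I => if {i, j} ⊆ I ∧ I ⊆ T then 1 else 0
    have hδ : ∀ I, 0 ≤ δ I := fun I => by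
      simp only [δ]
      split_ifs <;> norm_num
    have hsimp : ∀ I : Finset (Fin d), I.Nonempty →
        ∃ t, faceIn (stdSimp d I) u = {t} + δ I • S := by
      intro I hI
      by_cases h : {i, j} ⊆ I ∧ I ⊆ T
      · refine ⟨0, ?_⟩
        have := faceIn_stdSimp_of_subset hu1 hu5 h.1 h.2
        simp [δ, h, this, hS]
      · obtain ⟨k, hk⟩ := faceIn_stdSimp_of_not_subset hu1 hu hu4 hI h
        exact ⟨Pi.single k 1, by simp [δ, h, hk, Set.zero_smul_set hSne]⟩
    have hsmul : ∀ (I : Finset (Fin d)) (c : ℝ), I.Nonempty → 0 ≤ c →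
        ∃ t, faceIn (c • stdSimp d I) u = {t} + (c * δ I) • S := by
      intro I c hI hc
      obtain ⟨t, ht⟩ := hsimp I hI
      refine ⟨c • t, ?_⟩
      rw [faceIn_smul_of_nonneg hc (ht ▸ (Set.singleton_nonempty t).add hSne.smul_set), ht,
        smul_add, Set.smul_set_singleton, smul_smul]
    obtain ⟨t₁, ht₁⟩ := sum_singleton_add_smul
      (univ.filter fun I : Finset (Fin d) => I.Nonempty ∧ y I < 0) hSc hSne
      (fun I => faceIn ((-(y I)) • stdSimp d I) u) (fun I => -(y I) * δ I)
      (fun I hI => mul_nonneg (by linarith [(mem_filter.1 hI).2.2]) (hδ I))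
      (fun I hI => hsmul I _ (mem_filter.1 hI).2.1 (by linarith [(mem_filter.1 hI).2.2]))
    obtain ⟨t₂, ht₂⟩ := sum_singleton_add_smul
      (univ.filter fun I : Finset (Fin d) => I.Nonempty ∧ 0 ≤ y I) hSc hSne
      (fun I => faceIn (y I • stdSimp d I) u) (fun I => y I * δ I)
      (fun I hI => mul_nonneg (mem_filter.1 hI).2.2 (hδ I))
      (fun I hI => hsmul I _ (mem_filter.1 hI).2.1 (mem_filter.1 hI).2.2)
    have hneg : 0 ≤ ∑ I ∈ univ.filter (fun I : Finset (Fin d) => I.Nonempty ∧ y I < 0),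
        -(y I) * δ I :=
      sum_nonneg fun I hI => mul_nonneg (by linarith [(mem_filter.1 hI).2.2]) (hδ I)
    have hpos : 0 ≤ ∑ I ∈ univ.filter (fun I : Finset (Fin d) => I.Nonempty ∧ 0 ≤ y I),
        y I * δ I :=
      sum_nonneg fun I hI => mul_nonneg (mem_filter.1 hI).2.2 (hδ I)
    have hfaces := congrArg (fun X => faceIn X u) hsum
    simp only [faceIn_add, faceIn_sum] at hfaces
    rw [ht₁, ht₂, ht, add_add_add_comm, Set.singleton_add_singleton,
      ← hSc.add_smul ha hneg] at hfaces
    have hlen := translate_smul_segment_inj hij (add_nonneg ha hneg) hpos hfaces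
    have hval : a = ∑ I ∈ univ.filter
        (fun I : Finset (Fin d) => ({i, j} : Finset (Fin d)) ⊆ I ∧ I ⊆ T), y I := by
      rw [← eq_sub_iff_add_eq] at hlen
      rw [hlen, sum_filter, sum_filter, sum_filter, ← sum_sub_distrib]
      refine sum_congr rfl fun I _ => ?_
      by_cases h : {i, j} ⊆ I ∧ I ⊆ T
      · have hI : I.Nonempty := ⟨i, h.1 (by simp)⟩
        rcases lt_or_ge (y I) 0 with hy | hy
        · simp [δ, h, hI, hy, hy.not_ge]
        · simp [δ, h, hI, hy, hy.not_gt]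
      · simp [δ, h]
    rw [ht, hval]
end

section
/- Let d ≥ 2. For indices i, k, j ∈ {1,…,d−1}, define a_{ik} = C(i+1, 2)·C(d−i−1, k−i) and b_{kj} = (−1)^{k+j}·C(d−k−1, j−k) / C(j+1, 2). Then for all i, j ∈ {1,…,d−1}, Σ_{k=1}^{d−1} a_{ik}·b_{kj} equals 1 if i = j and 0 otherwise; that is, the (d−1)×(d−1) matrix A = (a_{ik}) is invertible with inverse B = (b_{kj}). -/
open Finset

theorem stmt6 (d : ℕ) (hd : 2 ≤ d) (i j : ℕ)
    (hi : i ∈ Finset.Icc 1 (d - 1)) (hj : j ∈ Finset.Icc 1 (d - 1)) :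
    (∑ k ∈ Finset.Icc 1 (d - 1),
        (((i + 1).choose 2 : ℝ) * (if i ≤ k then ((d - i - 1).choose (k - i) : ℝ) else 0)) *
          ((-1 : ℝ) ^ (k + j) * (if k ≤ j then ((d - k - 1).choose (j - k) : ℝ) else 0) /
            ((j + 1).choose 2 : ℝ)))
      = if i = j then 1 else 0 := by
  rw [Finset.mem_Icc] at hi hj
  rcases lt_or_ge j i with hji | hij
  · rw [if_neg (by omega)]
    refine Finset.sum_eq_zero fun k _ => ?_
    by_cases hk : i ≤ k
    · rw [if_neg (show ¬ k ≤ j by omega)]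
      simp
    · rw [if_neg hk]
      simp
  obtain ⟨m, rfl⟩ := Nat.exists_eq_add_of_le hij
  have hsub : Finset.Ico i (i + (m + 1)) ⊆ Finset.Icc 1 (d - 1) := fun k hk => by
    rw [Finset.mem_Ico] at hk
    rw [Finset.mem_Icc]
    omega
  rw [← Finset.sum_subset hsub, Finset.sum_Ico_eq_sum_range, Nat.add_sub_cancel_left]
  · have hterm : ∀ t ∈ Finset.range (m + 1),
        (((i + 1).choose 2 : ℝ) *
            (if i ≤ i + t then ((d - i - 1).choose (i + t - i) : ℝ) else 0)) *
          ((-1 : ℝ) ^ (i + t + (i + m)) *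
            (if i + t ≤ i + m then ((d - (i + t) - 1).choose (i + m - (i + t)) : ℝ) else 0) /
            ((i + m + 1).choose 2 : ℝ)) =
        ((i + 1).choose 2 : ℝ) / ((i + m + 1).choose 2 : ℝ) * (-1) ^ m *
          ((d - i - 1).choose m : ℝ) * ((-1) ^ t * (m.choose t : ℝ)) := fun t ht => by
      have htm : t ≤ m := Nat.lt_succ_iff.mp (Finset.mem_range.mp ht)
      have hmul : ((d - i - 1).choose m : ℝ) * m.choose t =
          (d - i - 1).choose t * (d - i - 1 - t).choose (m - t) := by
        exact_mod_cast Nat.choose_mul htm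
      have hpow : (-1 : ℝ) ^ (i + t + (i + m)) = (-1) ^ m * (-1) ^ t := by
        rw [show i + t + (i + m) = 2 * i + (m + t) by ring, pow_add, pow_mul, pow_add]
        simp
      rw [if_pos (by omega), if_pos (by omega), hpow, Nat.add_sub_cancel_left,
        Nat.add_sub_add_left, show d - (i + t) - 1 = d - i - 1 - t by omega]
      linear_combination (-((i + 1).choose 2 : ℝ) / ((i + m + 1).choose 2 : ℝ) *
        (-1) ^ m * (-1) ^ t) * hmul
    rw [Finset.sum_congr rfl hterm, ← Finset.mul_sum]
    have halt : ∑ t ∈ Finset.range (m + 1), (-1 : ℝ) ^ t * (m.choose t : ℝ) =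
        if m = 0 then 1 else 0 := by
      exact_mod_cast Int.alternating_sum_range_choose (n := m)
    rw [halt]
    rcases eq_or_ne m 0 with rfl | hm
    · have hpos : ((i + 1).choose 2 : ℝ) ≠ 0 :=
        Nat.cast_ne_zero.mpr (Nat.choose_pos (by omega)).ne'
      simp [div_self hpos]
    · simp [hm]
  · intro k _ hk
    rw [Finset.mem_Ico] at hk
    by_cases hik : i ≤ k
    · rw [if_neg (show ¬ k ≤ i + m by omega)]
      simp
    · rw [if_neg hik]
      simp
end

section
/- Let d ≥ 2 and let 1 ≤ k ≤ d − 1. Then Σ_{j=k}^{d−1} (−1)^{j+k} · C(d−k−1, j−k) · h_j / C(j+1, 2) ≥ 0, where h_j = 1 + 1/2 + ⋯ + 1/j is the j-th harmonic number. (These are the coordinates c_k of the Ehrhart linear-coefficient functional ℰ in the basis f_1,…,f_{d−1} of the cone of positive symmetric translation-invariant Minkowski linear functionals.) -/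
open Finset

/-- The `m`-th harmonic number `h_m = 1 + 1/2 + ⋯ + 1/m` (with `h_0 = 0`). -/
noncomputable def harm (m : ℕ) : ℝ := ∑ i ∈ Finset.Icc 1 m, (1 : ℝ) / i

/-- A real sequence is completely monotone if all its signed iterated differences
`(-1)ⁿ Δⁿ f` are nonnegative. -/
def IsCompletelyMonotone (f : ℕ → ℝ) : Prop :=
  ∀ n j, 0 ≤ (-1 : ℝ) ^ n * (fwdDiff 1)^[n] f j

theorem neg_one_pow_mul_fwdDiff_iter_eq {F : ℕ → ℕ → ℝ}
    (hF : ∀ n j, F n j - F n (j + 1) = F (n + 1) j) (n j : ℕ) :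
    (-1 : ℝ) ^ n * (fwdDiff 1)^[n] (F 0) j = F n j := by
  induction n generalizing j with
  | zero => simp
  | succ n ih =>
    rw [Function.iterate_succ_apply', fwdDiff, ← hF, ← ih, ← ih]
    ring

theorem neg_one_pow_mul_fwdDiff_iter_eq_sum (f : ℕ → ℝ) (n j : ℕ) :
    (-1 : ℝ) ^ n * (fwdDiff 1)^[n] f j =
      ∑ i ∈ range (n + 1), (-1 : ℝ) ^ i * (n.choose i : ℝ) * f (j + i) := by
  rw [fwdDiff_iter_eq_sum_shift, mul_sum]
  refine sum_congr rfl fun i hi => ?_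
  obtain ⟨m, rfl⟩ := Nat.exists_eq_add_of_le (Nat.le_of_lt_succ (mem_range.mp hi))
  have h : (-1 : ℝ) ^ m * (-1) ^ m = 1 := by rw [← mul_pow]; simp
  simp only [zsmul_eq_mul, smul_eq_mul, mul_one, Nat.add_sub_cancel_left]
  push_cast
  rw [pow_add]
  linear_combination ((-1 : ℝ) ^ i * ((i + m).choose i : ℝ) * f (j + i)) * h

namespace IsCompletelyMonotone

theorem of_family {F : ℕ → ℕ → ℝ} (hF : ∀ n j, F n j - F n (j + 1) = F (n + 1) j)
    (hpos : ∀ n j, 0 ≤ F n j) : IsCompletelyMonotone (F 0) := fun n j => by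
  rw [neg_one_pow_mul_fwdDiff_iter_eq hF]
  exact hpos n j

theorem shift {f : ℕ → ℝ} (hf : IsCompletelyMonotone f) :
    IsCompletelyMonotone fun j => f (j + 1) := fun n j => by
  have h := hf n (j + 1)
  rw [neg_one_pow_mul_fwdDiff_iter_eq_sum] at h ⊢
  simpa only [add_right_comm j 1] using h

theorem neg_fwdDiff {f : ℕ → ℝ} (hf : IsCompletelyMonotone f) :
    IsCompletelyMonotone ((-1 : ℝ) • fwdDiff 1 f) := fun n j => by
  have h := hf (n + 1) j
  rw [Function.iterate_succ_apply, pow_succ] at h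
  rw [fwdDiff_iter_const_smul]
  simpa [mul_assoc] using h

theorem mul {f g : ℕ → ℝ} (hf : IsCompletelyMonotone f) (hg : IsCompletelyMonotone g) :
    IsCompletelyMonotone (f * g) := fun n => by
  induction n generalizing f g with
  | zero =>
    intro j
    have h₁ := hf 0 j
    have h₂ := hg 0 j
    simp only [pow_zero, one_mul, Function.iterate_zero, id_eq, Pi.mul_apply] at h₁ h₂ ⊢
    exact mul_nonneg h₁ h₂
  | succ n ih =>
    intro j
    have leibniz : fwdDiff 1 (f * g) =
        (-1 : ℝ) • (((-1 : ℝ) • fwdDiff 1 f) * g +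
          (fun j => f (j + 1)) * ((-1 : ℝ) • fwdDiff 1 g)) := by
      ext i
      simp only [fwdDiff, Pi.smul_apply, Pi.mul_apply, Pi.add_apply, smul_eq_mul]
      ring
    have h₁ := ih hf.neg_fwdDiff hg j
    have h₂ := ih hf.shift hg.neg_fwdDiff j
    rw [Function.iterate_succ_apply, leibniz, fwdDiff_iter_const_smul, fwdDiff_iter_add]
    simp only [Pi.smul_apply, Pi.add_apply, smul_eq_mul]
    rw [pow_succ]
    linarith

end IsCompletelyMonotone

theorem harm_succ (m : ℕ) : harm (m + 1) = harm m + 1 / ((m : ℝ) + 1) := by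
  simp [harm, Finset.sum_Icc_succ_top]

theorem harm_mono : Monotone harm :=
  monotone_nat_of_le_succ fun m => by
    rw [harm_succ]
    exact le_add_of_nonneg_right (by positivity)

open Nat in
theorem isCompletelyMonotone_one_div_add_two :
    IsCompletelyMonotone fun j => 1 / ((j : ℝ) + 2) := by
  have h := IsCompletelyMonotone.of_family
    (F := fun n j => ((j + 1)! : ℝ) * (n ! : ℝ) / ((n + j + 2)! : ℝ)) (fun n j => by
      have e₁ : n + (j + 1) + 2 = n + j + 2 + 1 := by ring
      have e₂ : n + 1 + j + 2 = n + j + 2 + 1 := by ring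
      simp only [e₁, e₂, Nat.factorial_succ (n + j + 2), Nat.factorial_succ (j + 1),
        Nat.factorial_succ n]
      have : ((n + j + 2)! : ℝ) ≠ 0 := by positivity
      push_cast
      field_simp
      ring) (fun n j => by positivity)
  convert h using 2 with j
  rw [zero_add, Nat.factorial_succ (j + 1)]
  have : ((j + 1)! : ℝ) ≠ 0 := by positivity
  push_cast
  field_simp
  simp
  ring

open Nat in
theorem isCompletelyMonotone_harm_div :
    IsCompletelyMonotone fun j => harm (j + 1) / ((j : ℝ) + 1) := by
  have h := IsCompletelyMonotone.of_family
    (F := fun n j => (j ! : ℝ) * (n ! : ℝ) / ((n + j + 1)! : ℝ) *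
      (harm (n + j + 1) - harm n)) (fun n j => by
      have e₁ : n + (j + 1) + 1 = n + j + 1 + 1 := by ring
      have e₂ : n + 1 + j + 1 = n + j + 1 + 1 := by ring
      simp only [e₁, e₂, Nat.factorial_succ (n + j + 1), Nat.factorial_succ j,
        Nat.factorial_succ n, harm_succ (n + j + 1), harm_succ n]
      have : ((n + j + 1)! : ℝ) ≠ 0 := by positivity
      push_cast
      field_simp
      ring) (fun n j =>
        mul_nonneg (by positivity) (sub_nonneg.mpr (harm_mono (by omega))))
  convert h using 2 with j
  rw [zero_add, Nat.factorial_succ j]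
  have : (j ! : ℝ) ≠ 0 := by positivity
  have h₀ : harm 0 = 0 := by simp [harm]
  rw [h₀]
  push_cast
  field_simp
  simp

theorem stmt7 (d k : ℕ) (hd : 2 ≤ d) (hk : 1 ≤ k) (hk' : k ≤ d - 1) :
    0 ≤ ∑ j ∈ Finset.Icc k (d - 1),
        (-1 : ℝ) ^ (j + k) * ((d - k - 1).choose (j - k) : ℝ) * harm j /
          ((j + 1).choose 2 : ℝ) := by
  obtain ⟨m, rfl⟩ := Nat.exists_eq_add_of_le' hk
  obtain ⟨n, hn⟩ := Nat.exists_eq_add_of_le hk'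
  have hd' : d - (m + 1) - 1 = n := by omega
  have h := (isCompletelyMonotone_harm_div.mul isCompletelyMonotone_one_div_add_two) n m
  rw [neg_one_pow_mul_fwdDiff_iter_eq_sum] at h
  rw [hd', hn, ← Finset.Ico_add_one_right_eq_Icc, Finset.sum_Ico_eq_sum_range,
    show m + 1 + n + 1 - (m + 1) = n + 1 by omega]
  refine (mul_nonneg zero_le_two h).trans_eq ?_
  rw [mul_sum]
  refine sum_congr rfl fun i _ => ?_
  have hsign : (-1 : ℝ) ^ (m + 1 + i + (m + 1)) = (-1) ^ i := by
    rw [show m + 1 + i + (m + 1) = 2 * (m + 1) + i by ring, pow_add, pow_mul]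
    simp
  rw [hsign, Nat.add_sub_cancel_left, Nat.cast_choose_two, Pi.mul_apply,
    show m + 1 + i = m + i + 1 by ring]
  push_cast
  have h₁ : (m : ℝ) + i + 1 ≠ 0 := by positivity
  have h₂ : (m : ℝ) + i + 2 ≠ 0 := by positivity
  rw [show (m : ℝ) + i + 1 + 1 = m + i + 2 by ring,
    show (m : ℝ) + i + 2 - 1 = m + i + 1 by ring]
  field_simp
end
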